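/- arXiv:2404.17234 — 2 statements merged into one kernel-verified Lean document; each statement's English description precedes it below -/
import Mathlib

section
/- Let p be a prime, n ≥ 1 an integer, and ε ∈ ℤ. Let f : ℚ_p → ℚ_p be a definable function and set D = {x ∈ ℚ_p : x ≠ 0, v(x) ≥ ε, x ∈ P_n}. Assume the image f '' D is a finite set. Then there exist an integer δ ≥ ε and a positive multiple m of n such that f is constant on {x ∈ ℚ_p : x ≠ 0, v(x) ≥ δ, x ∈ P_m}. -/
open FirstOrder Filter Topology

/-- The ring-language structure on `ℚ_[p]`. -/
noncomputable instance (p : ℕ) [Fact p.Prime] : FirstOrder.Language.ring.Structure ℚ_[p] :=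
  (FirstOrder.Ring.compatibleRingOfRing ℚ_[p]).toStructure

section PowEquiv

variable {K : Type*} [Field K]

/-- `x` and `y` differ by a nonzero `n`-th power. -/
def PowEquiv (n : ℕ) (x y : K) : Prop := ∃ z : K, z ≠ 0 ∧ x = y * z ^ n

namespace PowEquiv

variable {n m : ℕ} {x y z x' y' : K}

theorem refl (n : ℕ) (x : K) : PowEquiv n x x := ⟨1, one_ne_zero, by simp⟩

theorem symm (h : PowEquiv n x y) : PowEquiv n y x := by
  obtain ⟨z, hz, rfl⟩ := h
  exact ⟨z⁻¹, inv_ne_zero hz, by rw [mul_assoc, ← mul_pow, mul_inv_cancel₀ hz]; simp⟩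

theorem trans (h : PowEquiv n x y) (h' : PowEquiv n y z) : PowEquiv n x z := by
  obtain ⟨a, ha, rfl⟩ := h
  obtain ⟨b, hb, rfl⟩ := h'
  exact ⟨b * a, mul_ne_zero hb ha, by ring⟩

theorem mul (h : PowEquiv n x y) (h' : PowEquiv n x' y') : PowEquiv n (x * x') (y * y') := by
  obtain ⟨a, ha, rfl⟩ := h
  obtain ⟨b, hb, rfl⟩ := h'
  exact ⟨a * b, mul_ne_zero ha hb, by ring⟩

theorem pow (h : PowEquiv n x y) (k : ℕ) : PowEquiv n (x ^ k) (y ^ k) := by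
  obtain ⟨a, ha, rfl⟩ := h
  exact ⟨a ^ k, pow_ne_zero _ ha, by ring⟩

theorem of_dvd (h : PowEquiv m x y) (hn : n ∣ m) : PowEquiv n x y := by
  obtain ⟨a, ha, rfl⟩ := h
  obtain ⟨k, rfl⟩ := hn
  exact ⟨a ^ k, pow_ne_zero _ ha, by ring⟩

theorem eq_zero_iff (h : PowEquiv n x y) : x = 0 ↔ y = 0 := by
  obtain ⟨a, ha, rfl⟩ := h
  simp [ha]

end PowEquiv

end PowEquiv

section Coarse

open Polynomial

variable {K Γ₀ : Type*} [Field K] [LinearOrderedCommGroupWithZero Γ₀]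

/-- The properties of an ultrapower of `ℚ_p`, with the valuation whose ring consists of the bounded
elements, that are used in the back-and-forth argument. -/
structure CoarselyHenselian (v : Valuation K Γ₀) : Prop where
  exists_lt_one : ∃ x : K, x ≠ 0 ∧ v x < 1
  map_natCast : ∀ n : ℕ, n ≠ 0 → v n = 1
  exists_root : ∀ G : K[X], G.coeff 0 = 1 → G.coeff 1 = 1 → (∀ l, 2 ≤ l → v (G.coeff l) < 1) →
    ∃ w : K, v w ≤ 1 ∧ G.eval w = 0
  exists_pow_eq : ∀ n : ℕ, 0 < n → ∀ x : K, x ≠ 0 → ∃ q : ℕ, q ≠ 0 ∧ ∃ y : K, y ^ n = q * x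
  sub_lt_one : ∀ x x' : K, v x ≤ 1 → (∀ t : ℚ, PowEquiv 2 (x - t) (x' - t)) → v (x - x') < 1

variable {v : Valuation K Γ₀}

theorem Valuation.eval_le {G : K[X]} {u : K} {M : Γ₀} (h : ∀ l, v (G.coeff l) * v u ^ l ≤ M) :
    v (G.eval u) ≤ M := by
  rw [eval_eq_sum_range]
  exact v.map_sum_le fun l _ => by simpa using h l

theorem Valuation.eval_lt {G : K[X]} {u : K} {M : Γ₀} (hM : M ≠ 0)
    (h : ∀ l, v (G.coeff l) * v u ^ l < M) : v (G.eval u) < M := by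
  rw [eval_eq_sum_range]
  exact v.map_sum_lt hM fun l _ => by simpa using h l

theorem Polynomial.coeff_taylor_eq_sum {R : Type*} [CommRing R] (G : R[X]) (c : R) (l : ℕ) :
    (taylor c G).coeff l =
      ∑ k ∈ Finset.range (G.natDegree + 1), G.coeff k * (c ^ (k - l) * (k.choose l)) := by
  rw [taylor_apply, comp, eval₂_eq_sum_range, finsetSum_coeff]
  exact Finset.sum_congr rfl fun k _ => by rw [coeff_C_mul, coeff_X_add_C_pow]

theorem Valuation.map_natCast_le_one (v : Valuation K Γ₀) (n : ℕ) : v n ≤ 1 := by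
  induction n with
  | zero => simp
  | succ n ih => simpa using v.map_add_le ih (by simp)

/-- The bound on the Taylor coefficients is unchanged when the centre moves inside the ball. -/
theorem Valuation.taylor_coeff_le {G : K[X]} {c c' : K} {γ M : Γ₀} (hc : v (c' - c) ≤ γ) {i : ℕ}
    (h : ∀ l, i ≤ l → v ((taylor c G).coeff l) * γ ^ l ≤ M) (l : ℕ) (hl : i ≤ l) :
    v ((taylor c' G).coeff l) * γ ^ l ≤ M := by
  have : taylor c' G = taylor (c' - c) (taylor c G) := by rw [taylor_taylor]; simp
  rw [this, coeff_taylor_eq_sum]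
  rcases eq_or_ne γ 0 with rfl | hγ
  · rw [le_zero_iff, map_eq_zero, sub_eq_zero] at hc
    subst hc
    rw [← coeff_taylor_eq_sum]
    simpa using h l hl
  rw [← le_div_iff₀ (pow_pos (zero_lt_iff.2 hγ) _)]
  refine v.map_sum_le fun k _ => ?_
  rw [le_div_iff₀ (pow_pos (zero_lt_iff.2 hγ) _)]
  rcases lt_or_ge k l with hk | hk
  · simp [Nat.choose_eq_zero_of_lt hk]
  calc v ((taylor c G).coeff k * ((c' - c) ^ (k - l) * (k.choose l))) * γ ^ l
      = v ((taylor c G).coeff k) * (v (c' - c) ^ (k - l) * v (k.choose l)) * γ ^ l := by simp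
    _ ≤ v ((taylor c G).coeff k) * (γ ^ (k - l) * 1) * γ ^ l := by
        gcongr
        exact v.map_natCast_le_one _
    _ = v ((taylor c G).coeff k) * γ ^ k := by
        rw [mul_one, mul_assoc, ← pow_add, Nat.sub_add_cancel hk]
    _ ≤ M := h k (hl.trans hk)

theorem Valuation.sub_mul_lt_one {x y x' y' : K} (hx : v x ≤ 1) (hy' : v y' ≤ 1) (h : v (x - x') < 1)
    (h' : v (y - y') < 1) : v (x * y - x' * y') < 1 := by
  rw [show x * y - x' * y' = x * (y - y') + (x - x') * y' by ring]
  refine v.map_add_lt ?_ ?_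
  · rw [map_mul]; exact mul_lt_one_of_nonneg_of_lt_one_right hx zero_le h'
  · rw [map_mul]; exact mul_lt_one_of_nonneg_of_lt_one_left zero_le h hy'

theorem Valuation.map_le_one_of_sub {x x' : K} (hx : v x ≤ 1) (h : v (x - x') < 1) : v x' ≤ 1 := by
  rw [show x' = x - (x - x') by ring]
  exact v.map_sub_le hx h.le

theorem Valuation.sub_pow_lt_one {x x' : K} (hx : v x ≤ 1) (h : v (x - x') < 1) (l : ℕ) :
    v (x ^ l - x' ^ l) < 1 := by
  induction l with
  | zero => simp
  | succ l ih =>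
    rw [pow_succ, pow_succ]
    exact Valuation.sub_mul_lt_one (by simpa using pow_le_one' hx l) (Valuation.map_le_one_of_sub hx h) ih h

theorem Valuation.taylor_coeff_mono {F : Type*} [Field F] {i : F →+* K} {g : F[X]} {b : K} {c c' : F} {M : Γ₀}
    (hc : v (b - i c') ≤ v (b - i c))
    (h : ∀ l, v (i ((taylor c g).coeff l)) * v (b - i c) ^ l ≤ M) (l : ℕ) :
    v (i ((taylor c' g).coeff l)) * v (b - i c') ^ l ≤ M := by
  have h1 : ∀ c l, i ((taylor c g).coeff l) = (taylor (i c) (g.map i)).coeff l := fun c l => by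
    rw [← map_taylor, coeff_map]
  simp only [h1] at h ⊢
  refine le_trans ?_ (Valuation.taylor_coeff_le (i := 0) (c' := i c') ?_ (fun l _ => h l) l
    l.zero_le)
  · gcongr
  · rw [show i c' - i c = (b - i c) - (b - i c') by ring]
    exact v.map_sub_le le_rfl hc

namespace CoarselyHenselian

variable (hv : CoarselyHenselian v)
include hv

theorem exists_root_near {G : K[X]} {x : K} {γ : Γ₀}
    (h : ∀ l, 2 ≤ l → v ((taylor x G).coeff l) * γ ^ l ≤ v (G.derivative.eval x) * γ)
    (h0 : v (G.eval x) < v (G.derivative.eval x) * γ) :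
    ∃ β, G.eval β = 0 ∧ v (β - x) * v (G.derivative.eval x) = v (G.eval x) := by
  by_cases hG : G.eval x = 0
  · exact ⟨x, hG, by simp [hG]⟩
  have hγ : γ ≠ 0 := by rintro rfl; simp at h0
  have h1 : G.derivative.eval x ≠ 0 := by
    intro h1
    simp [h1] at h0
  set a := G.eval x
  set b := G.derivative.eval x
  have hv0 : v a ≠ 0 := by simpa using hG
  have hv1 : v b ≠ 0 := by simpa using h1
  set H : K[X] := C a⁻¹ * (taylor x G).comp (C (a / b) * X) with hH
  have hcoeff : ∀ l, H.coeff l = a⁻¹ * ((taylor x G).coeff l * (a / b) ^ l) := fun l => by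
    rw [hH, coeff_C_mul, comp_C_mul_X_coeff]
  have hH0 : H.coeff 0 = 1 := by
    rw [hcoeff, taylor_coeff_zero, pow_zero, mul_one, inv_mul_cancel₀ hG]
  have hH1 : H.coeff 1 = 1 := by
    rw [hcoeff, taylor_coeff_one, pow_one]
    change a⁻¹ * (b * (a / b)) = 1
    field_simp
  have hH2 : ∀ l, 2 ≤ l → v (H.coeff l) < 1 := by
    intro l hl
    obtain ⟨k, rfl⟩ : ∃ k, l = k + 1 := ⟨l - 1, by omega⟩
    have hlt : v (a / b) < γ := by
      rw [map_div₀, div_lt_iff₀ (zero_lt_iff.2 hv1), mul_comm]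
      exact h0
    have hba : a⁻¹ * (a / b) = b⁻¹ := by field_simp
    rw [hcoeff, show a⁻¹ * ((taylor x G).coeff (k + 1) * (a / b) ^ (k + 1)) =
      b⁻¹ * ((taylor x G).coeff (k + 1) * (a / b) ^ k) by rw [← hba]; ring, map_mul, map_inv₀,
      inv_mul_lt_iff₀ (zero_lt_iff.2 hv1), mul_one, map_mul, map_pow]
    rcases eq_or_ne (v ((taylor x G).coeff (k + 1))) 0 with hz | hz
    · rw [hz, zero_mul]; exact zero_lt_iff.2 hv1
    refine lt_of_lt_of_le (b := v ((taylor x G).coeff (k + 1)) * γ ^ k) ?_ ?_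
    · exact mul_lt_mul_of_pos_left (pow_lt_pow_left₀ hlt zero_le (by omega)) (zero_lt_iff.2 hz)
    · have := h (k + 1) hl
      rw [pow_succ, ← mul_assoc] at this
      exact le_of_mul_le_mul_right this (zero_lt_iff.2 hγ)
  obtain ⟨w, hw, hw0⟩ := hv.exists_root H hH0 hH1 hH2
  have hw1 : v w = 1 := by
    have hsmall : v ((H - 1 - X).eval w) < 1 := by
      refine Valuation.eval_lt one_ne_zero fun l => ?_
      rcases l with _ | _ | l
      · simp [hH0]
      · simp [hH1, coeff_one]
      · have h2 := hH2 (l + 2) (by omega)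
        have : (H - 1 - X).coeff (l + 2) = H.coeff (l + 2) := by simp [coeff_one, coeff_X]
        rw [this]
        exact lt_of_le_of_lt (mul_le_of_le_one_right' (pow_le_one' hw _)) h2
    have : v (-1 - w) < v (-1 : K) := by
      simpa [hw0] using hsmall
    rw [v.map_eq_of_sub_lt (x := -1) (y := w)]
    · simp
    · rwa [v.map_sub_swap]
  refine ⟨x + a / b * w, ?_, ?_⟩
  · have : H.eval w = a⁻¹ * G.eval (x + a / b * w) := by
      simp only [hH, eval_mul, eval_C, eval_comp, taylor_eval, eval_X]
      rw [add_comm]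
    rw [this] at hw0
    exact (mul_eq_zero.1 hw0).resolve_left (inv_ne_zero hG)
  · rw [add_sub_cancel_left, map_mul, hw1, mul_one, ← map_mul, div_mul_cancel₀ _ h1]

theorem charZero : CharZero K := by
  refine charZero_of_inj_zero fun n hn => ?_
  by_contra h
  simpa [hn] using hv.map_natCast n h

theorem map_natCast_mul (n : ℕ) (hn : n ≠ 0) (x : K) : v (n * x) = v x := by
  rw [map_mul, hv.map_natCast n hn, one_mul]

theorem powEquiv_of_sub_lt {n : ℕ} (hn : 0 < n) {x y : K} (h : v (x - y) < v y) :
    PowEquiv n x y := by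
  have hy : y ≠ 0 := by rintro rfl; simp at h
  set G : K[X] := X ^ n - C (x / y) with hG
  have hd : G.derivative.eval 1 = n := by simp [hG, derivative_X_pow]
  have ht : taylor 1 G = (X + 1) ^ n - C (x / y) := by simp [hG]
  have h0 : v (G.eval 1) < 1 := by
    have : G.eval 1 = (y - x) / y := by simp [hG]; field_simp
    rw [this, map_div₀, div_lt_one₀ (zero_lt_iff.2 (by simpa using hy)), v.map_sub_swap]
    exact h
  obtain ⟨β, hβ, hβ'⟩ := hv.exists_root_near (G := G) (x := 1) (γ := 1) (fun l hl => by
    rw [hd, hv.map_natCast n hn.ne', ht, coeff_sub, coeff_X_add_one_pow, coeff_C,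
      if_neg (by omega), sub_zero]
    simpa using v.map_natCast_le_one _) (by rw [hd, hv.map_natCast n hn.ne', mul_one]; exact h0)
  rw [hd, hv.map_natCast n hn.ne', mul_one] at hβ'
  have hβ0 : β ≠ 0 := by
    rintro rfl
    simp [← hβ'] at h0
  refine ⟨β, hβ0, ?_⟩
  have : β ^ n = x / y := by simpa [hG, sub_eq_zero] using hβ
  rw [this, mul_div_cancel₀ _ hy]

section PartialIso

variable {F : Type*} [Field F] {i j : F →+* K} (hij : ∀ n : ℕ, 0 < n → ∀ x, PowEquiv n (i x) (j x))
include hij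

theorem map_sub_map_lt_one {x : F} (hx : v (i x) ≤ 1) : v (i x - j x) < 1 := by
  refine hv.sub_lt_one _ _ hx fun t => ?_
  simpa using hij 2 two_pos (x - t)

theorem map_le_map_of_le {x y : F} (h : v (i x) ≤ v (i y)) : v (j x) ≤ v (j y) := by
  rcases eq_or_ne y 0 with rfl | hy
  · have : x = 0 := by simpa using h
    simp [this]
  have h1 : v (i (x / y)) ≤ 1 := by
    rw [map_div₀, map_div₀]
    exact div_le_one_of_le₀ h zero_le
  have := Valuation.map_le_one_of_sub h1 (hv.map_sub_map_lt_one hij h1)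
  rwa [map_div₀, map_div₀, div_le_one₀ (zero_lt_iff.2 (by simpa using hy))] at this

theorem map_le_map_iff {x y : F} : v (i x) ≤ v (i y) ↔ v (j x) ≤ v (j y) :=
  ⟨hv.map_le_map_of_le hij, hv.map_le_map_of_le fun n hn x => (hij n hn x).symm⟩

theorem map_lt_map_iff {x y : F} : v (i x) < v (i y) ↔ v (j x) < v (j y) := by
  rw [← not_le, ← not_le, hv.map_le_map_iff hij]

theorem map_eq_map_iff {x y : F} : v (i x) = v (i y) ↔ v (j x) = v (j y) := by
  simp only [le_antisymm_iff, hv.map_le_map_iff hij]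

theorem eval₂_sub_lt_one {h : F[X]} (hc : ∀ l, v (i (h.coeff l)) ≤ 1) {u u' : K} (hu : v u ≤ 1)
    (huu : v (u - u') < 1) : v (h.eval₂ i u - h.eval₂ j u') < 1 := by
  rw [eval₂_eq_sum_range, eval₂_eq_sum_range, ← Finset.sum_sub_distrib]
  refine v.map_sum_lt one_ne_zero fun l _ => ?_
  refine Valuation.sub_mul_lt_one (hc l) ?_ (hv.map_sub_map_lt_one hij (hc l)) (Valuation.sub_pow_lt_one hu huu l)
  simpa using pow_le_one' (Valuation.map_le_one_of_sub hu huu) l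

omit hij in
omit hv in
theorem _root_.Polynomial.eval₂_rescale (i : F →+* K) (h : F[X]) (a e : F) (u : K) :
    (C a * h.comp (C e * X)).eval₂ i u = i a * h.eval₂ i (i e * u) := by
  rw [eval₂_mul, eval₂_C, eval₂_comp, eval₂_mul, eval₂_C, eval₂_X]

theorem powEquiv_eval₂_of_unit {h : F[X]} {e : F} {u u' : K} (hu : v u ≤ 1)
    (huu : v (u - u') < 1)
    (hb : ∀ l, v (i (h.coeff l)) * v (i e) ^ l ≤ v (h.eval₂ i (i e * u))) {n : ℕ} (hn : 0 < n) :
    PowEquiv n (h.eval₂ i (i e * u)) (h.eval₂ j (j e * u')) := by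
  rcases eq_or_ne (h.eval₂ i (i e * u)) 0 with h0 | h0
  · have h1 : ∀ l, h.coeff l * e ^ l = 0 := fun l => by
      have := hb l
      rw [h0, map_zero, le_zero_iff, ← map_pow, ← map_mul, ← map_pow, ← map_mul, map_eq_zero,
        map_eq_zero] at this
      exact this
    have h2 : h.eval₂ j (j e * u') = 0 := by
      rw [eval₂_eq_sum_range]
      refine Finset.sum_eq_zero fun l _ => ?_
      rw [mul_pow, ← mul_assoc, ← map_pow, ← map_mul, h1, map_zero, zero_mul]
    rw [h0, h2]
    exact .refl _ _
  have hv0 : v (h.eval₂ i (i e * u)) ≠ 0 := by simpa using h0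
  obtain ⟨l, hl⟩ : ∃ l, v (i (h.coeff l * e ^ l)) = v (h.eval₂ i (i e * u)) := by
    by_contra! hne
    refine lt_irrefl (v (h.eval₂ i (i e * u))) ?_
    conv_lhs => rw [← eval_map]
    refine Valuation.eval_lt hv0 fun l => lt_of_le_of_lt ?_ (lt_of_le_of_ne (hb l) ?_)
    · rw [coeff_map, map_mul, mul_pow, ← mul_assoc]
      exact mul_le_of_le_one_right' (pow_le_one' hu l)
    · simpa using hne l
  set A := h.coeff l * e ^ l
  have hA : A ≠ 0 := by
    rintro hA
    rw [hA, map_zero, map_zero] at hl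
    exact hv0 hl.symm
  have hiA : v (i A) ≠ 0 := by simpa using hA
  set H : F[X] := C A⁻¹ * h.comp (C e * X) with hH
  have hHc : ∀ l, v (i (H.coeff l)) ≤ 1 := fun l => by
    rw [hH, coeff_C_mul, comp_C_mul_X_coeff, map_mul, map_inv₀, map_mul, map_inv₀,
      inv_mul_le_iff₀ (zero_lt_iff.2 hiA), mul_one, hl]
    simpa using hb l
  have hHi : v (H.eval₂ i u) = 1 := by
    rw [hH, eval₂_rescale, map_inv₀, map_mul, map_inv₀, hl, inv_mul_cancel₀ hv0]
  have hlt := hv.eval₂_sub_lt_one hij hHc hu huu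
  have hE : PowEquiv n (H.eval₂ j u') (H.eval₂ i u) := by
    refine hv.powEquiv_of_sub_lt hn ?_
    rwa [hHi, v.map_sub_swap]
  have := (hij n hn A).mul hE.symm
  have e1 : ∀ (k : F →+* K) (w : K), k A * H.eval₂ k w = h.eval₂ k (k e * w) := fun k w => by
    rw [hH, eval₂_rescale, map_inv₀, mul_inv_cancel_left₀ (by simpa using hA)]
  rwa [e1, e1] at this

omit hij in
theorem powEquiv_eval_of_dominant {G : K[X]} {x : K} {ν : ℕ}
    (hG : ∀ l, l ≠ ν → v (G.coeff l) * v x ^ l < v (G.coeff ν) * v x ^ ν) {n : ℕ} (hn : 0 < n) :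
    PowEquiv n (G.eval x) (G.coeff ν * x ^ ν) := by
  have hM : v (G.coeff ν) * v x ^ ν ≠ 0 := ne_zero_of_lt (hG (ν + 1) (by omega))
  refine hv.powEquiv_of_sub_lt hn ?_
  have : G.eval x - G.coeff ν * x ^ ν = (G - monomial ν (G.coeff ν)).eval x := by simp
  rw [this, map_mul, map_pow]
  refine Valuation.eval_lt hM fun l => ?_
  rw [coeff_sub, coeff_monomial]
  split_ifs with h
  · subst h; simpa using zero_lt_iff.2 hM
  · simpa using hG l (Ne.symm h)

theorem powEquiv_eval₂_of_dominant {h : F[X]} {x x' : K} {ν n : ℕ} (hn : 0 < n)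
    (hx : PowEquiv n x x')
    (hi : ∀ l, l ≠ ν → v (i (h.coeff l)) * v x ^ l < v (i (h.coeff ν)) * v x ^ ν)
    (hj : ∀ l, l ≠ ν → v (j (h.coeff l)) * v x' ^ l < v (j (h.coeff ν)) * v x' ^ ν) :
    PowEquiv n (h.eval₂ i x) (h.eval₂ j x') := by
  have h1 := hv.powEquiv_eval_of_dominant (G := h.map i) (x := x) (by simpa using hi) hn
  have h2 := hv.powEquiv_eval_of_dominant (G := h.map j) (x := x') (by simpa using hj) hn
  rw [eval_map, coeff_map] at h1 h2
  exact h1.trans (((hij n hn _).mul (hx.pow ν)).trans h2.symm)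

end PartialIso

end CoarselyHenselian
end Coarse

section Coarse

open Polynomial

variable {K Γ₀ : Type*} [Field K] [LinearOrderedCommGroupWithZero Γ₀] {v : Valuation K Γ₀}

namespace CoarselyHenselian

variable (hv : CoarselyHenselian v) {F : Type*} [Field F] {i : F →+* K} {d : ℕ}
  (hcl : ∀ h : F[X], h ≠ 0 → h.natDegree < d → ∀ β, h.eval₂ i β = 0 → β ∈ i.range)
include hv hcl

theorem exists_centre_single {b : K} (hb : b ∉ i.range) (m : ℕ) :
    ∀ g : F[X], g.natDegree ≤ m → m < d →
    ∃ c : F, ∀ l, v (i ((taylor c g).coeff l)) * v (b - i c) ^ l ≤ v (g.eval₂ i b) := by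
  induction m with
  | zero =>
    intro g hg _
    obtain ⟨a, rfl⟩ := natDegree_eq_zero.1 (Nat.le_zero.1 hg)
    refine ⟨0, fun l => ?_⟩
    rcases l with _ | l <;> simp [coeff_C]
  | succ m ih =>
    intro g hg hm
    have hder : g.derivative.natDegree ≤ m := (natDegree_derivative_le g).trans (by omega)
    obtain ⟨c, hc⟩ := ih g.derivative hder (by omega)
    set γ := v (b - i c) with hγ
    set M := v (g.derivative.eval₂ i b) with hM
    have hγ0 : γ ≠ 0 := by
      rw [hγ, Valuation.ne_zero_iff, sub_ne_zero]
      rintro rfl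
      exact hb ⟨c, rfl⟩
    have hcoef : ∀ (G : K[X]) (x : K) (l : ℕ),
        v ((taylor x (derivative G)).coeff l) = v ((taylor x G).coeff (l + 1)) := fun G x l => by
      have : taylor x (derivative G) = derivative (taylor x G) := by
        simp [taylor_apply, derivative_comp]
      rw [this, coeff_derivative, mul_comm, ← Nat.cast_succ, hv.map_natCast_mul _ (by omega)]
    have hmap : ∀ (c : F) (p : F[X]) l,
        i ((taylor c p).coeff l) = (taylor (i c) (p.map i)).coeff l := fun c p l => by
      rw [← map_taylor, coeff_map]
    -- the bound for the positive coefficients at a point of the ball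
    have hpos : ∀ x, v (x - i c) ≤ γ → ∀ l, v ((taylor x (g.map i)).coeff (l + 1)) * γ ^ l ≤ M := by
      intro x hx l
      rw [← hcoef, derivative_map]
      refine Valuation.taylor_coeff_le (i := 0) hx (fun l _ => ?_) l l.zero_le
      rw [← hmap]
      exact hc l
    rcases le_or_gt (M * γ) (v (g.eval₂ i b)) with hle | hlt
    · refine ⟨c, ?_⟩
      have hsucc : ∀ l, v (i ((taylor c g).coeff (l + 1))) * γ ^ (l + 1) ≤ v (g.eval₂ i b) := by
        intro l
        refine le_trans ?_ hle
        rw [pow_succ, ← mul_assoc, hmap]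
        gcongr
        exact hpos (i c) (by simp) l
      rintro (_ | l)
      · have h0 : i ((taylor c g).coeff 0) = g.eval₂ i b -
            (taylor (i c) (g.map i) - C ((taylor (i c) (g.map i)).coeff 0)).eval (b - i c) := by
          rw [eval_sub, taylor_eval, sub_add_cancel, eval_C, eval_map, hmap]
          ring
        rw [pow_zero, mul_one, h0]
        refine v.map_sub_le le_rfl (Valuation.eval_le fun l => ?_)
        rcases l with _ | l
        · simp
        · simpa [hmap, coeff_C] using hsucc l
      · exact hsucc l
    · have hγle : v (b - i c) ≤ γ := le_rfl
      have hev : (g.map i).derivative.eval b = g.derivative.eval₂ i b := by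
        rw [derivative_map, eval_map]
      obtain ⟨β, hβ, hβb⟩ := hv.exists_root_near (G := g.map i) (x := b) (γ := γ) (fun l hl => by
          obtain ⟨k, rfl⟩ : ∃ k, l = k + 1 := ⟨l - 1, by omega⟩
          rw [pow_succ, ← mul_assoc, hev]
          gcongr
          exact hpos b hγle k) (by rwa [hev, eval_map])
      rw [hev, eval_map] at hβb
      have hM0 : M ≠ 0 := by
        intro h
        rw [h, zero_mul] at hlt
        exact not_lt_zero hlt
      obtain ⟨c', rfl⟩ : β ∈ i.range := by
        refine hcl g ?_ (by omega) β (by rwa [eval_map] at hβ)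
        rintro rfl
        simp [hM] at hM0
      have hlt' : v (i c' - b) < γ := by
        rw [← hβb, mul_comm, mul_lt_mul_iff_right₀ (zero_lt_iff.2 hM0)] at hlt
        exact hlt
      refine ⟨c', ?_⟩
      rintro (_ | l)
      · rw [hmap, taylor_coeff_zero, hβ]; simp
      · rw [← hβb, v.map_sub_swap, pow_succ, ← mul_assoc, mul_comm _ M]
        have hin : v (i c' - i c) ≤ γ := by
          rw [show i c' - i c = (i c' - b) + (b - i c) by ring]
          exact v.map_add_le hlt'.le le_rfl
        gcongr
        refine le_trans ?_ (hpos (i c') hin l)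
        rw [hmap]
        gcongr

theorem exists_centre {b : K} (hb : b ∉ i.range) (s : Finset F[X])
    (hs : ∀ g ∈ s, g.natDegree < d) :
    ∃ c : F, ∀ g ∈ s, ∀ l, v (i ((taylor c g).coeff l)) * v (b - i c) ^ l ≤ v (g.eval₂ i b) := by
  classical
  induction s using Finset.induction_on with
  | empty => exact ⟨0, by simp⟩
  | insert g s _ ih =>
    obtain ⟨c, hc⟩ := ih fun g hg => hs g (Finset.mem_insert_of_mem hg)
    obtain ⟨c', hc'⟩ := hv.exists_centre_single hcl hb _ g le_rfl (hs g (Finset.mem_insert_self _ _))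
    rcases le_total (v (b - i c)) (v (b - i c')) with h | h
    · refine ⟨c, fun p hp => ?_⟩
      rcases Finset.mem_insert.1 hp with rfl | hp
      · exact Valuation.taylor_coeff_mono h hc'
      · exact hc p hp
    · refine ⟨c', fun p hp => ?_⟩
      rcases Finset.mem_insert.1 hp with rfl | hp
      · exact hc'
      · exact Valuation.taylor_coeff_mono h (hc p hp)

theorem exists_map_pow_eq {m : ℕ} (hm : 0 < m) (hmd : m < d) {x : F} (hx : x ≠ 0) :
    ∃ e : F, e ≠ 0 ∧ v (i e) ^ m = v (i x) := by
  obtain ⟨q, hq, y, hy⟩ := hv.exists_pow_eq m hm (i x) (by simpa using hx)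
  obtain ⟨e, rfl⟩ := hcl (X ^ m - C (q * x)) (X_pow_sub_C_ne_zero hm _)
    (by rwa [natDegree_X_pow_sub_C]) y (by simp [eval₂_sub, eval₂_X_pow, hy])
  have : v (i e) ^ m = v (i x) := by
    rw [← map_pow, hy, hv.map_natCast_mul q hq]
  refine ⟨e, ?_, this⟩
  rintro rfl
  rw [map_zero, map_zero, zero_pow hm.ne', eq_comm, map_eq_zero, map_eq_zero] at this
  exact hx this

theorem exists_map_eq_mul_pow {m : ℕ} (hm : 0 < m) (hmd : m < d) {x y : F} (hx : x ≠ 0) (hy : y ≠ 0) :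
    ∃ e : F, e ≠ 0 ∧ v (i x) = v (i y) * v (i e) ^ m := by
  obtain ⟨e, he, h⟩ := hv.exists_map_pow_eq hcl hm hmd (div_ne_zero hx hy)
  refine ⟨e, he, ?_⟩
  rw [h, map_div₀, map_div₀, mul_div_cancel₀]
  simpa using hy

/-- Two terms of a polynomial have different valuations at a point whose valuation is new. -/
theorem map_mul_pow_ne {γ : Γ₀} (hγ0 : γ ≠ 0) (hγ : ∀ e : F, v (i e) ≠ γ) {l k : ℕ} (hlk : l < k)
    (hk : k - l < d) {x y : F} (hx : x ≠ 0) (hy : y ≠ 0) :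
    v (i x) * γ ^ l ≠ v (i y) * γ ^ k := by
  intro h
  obtain ⟨e, he, hxy⟩ := hv.exists_map_eq_mul_pow hcl (Nat.sub_pos_of_lt hlk) hk hx hy
  rw [hxy, ← Nat.sub_add_cancel hlk.le, pow_add, ← mul_assoc, Nat.add_sub_cancel] at h
  have h1 := mul_right_cancel₀ (pow_ne_zero l hγ0) h
  have h2 := mul_left_cancel₀ (by simpa using hy) h1
  exact hγ e ((pow_left_inj₀ zero_le zero_le (by omega)).1 h2)

end CoarselyHenselian
end Coarse

section Coarse

open Polynomial

variable {K Γ₀ : Type*} [Field K] [LinearOrderedCommGroupWithZero Γ₀] {v : Valuation K Γ₀}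

theorem mul_pow_mul_lt_iff {B E γ : Γ₀} {l k : ℕ} (hB : B ≠ 0) (hγ : γ ≠ 0) (hlk : l < k) :
    B * E ^ (k - l) * γ ^ l < B * γ ^ k ↔ E < γ := by
  obtain ⟨m, rfl⟩ := Nat.exists_eq_add_of_lt hlk
  rw [show l + m + 1 - l = m + 1 by omega, show l + m + 1 = (m + 1) + l by omega, pow_add γ,
    ← mul_assoc, mul_lt_mul_iff_left₀ (pow_pos (zero_lt_iff.2 hγ) l),
    mul_lt_mul_iff_right₀ (zero_lt_iff.2 hB), pow_lt_pow_iff_left₀ zero_le zero_le m.succ_ne_zero]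

theorem mul_lt_mul_pow_mul_iff {B E γ : Γ₀} {l k : ℕ} (hB : B ≠ 0) (hγ : γ ≠ 0) (hlk : l < k) :
    B * γ ^ k < B * E ^ (k - l) * γ ^ l ↔ γ < E := by
  obtain ⟨m, rfl⟩ := Nat.exists_eq_add_of_lt hlk
  rw [show l + m + 1 - l = m + 1 by omega, show l + m + 1 = (m + 1) + l by omega, pow_add γ,
    ← mul_assoc, mul_lt_mul_iff_left₀ (pow_pos (zero_lt_iff.2 hγ) l),
    mul_lt_mul_iff_right₀ (zero_lt_iff.2 hB), pow_lt_pow_iff_left₀ zero_le zero_le m.succ_ne_zero]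

theorem Valuation.exists_max_term {F : Type*} [Field F] (i : F →+* K) {h : F[X]} (hh : h ≠ 0)
    {γ : Γ₀} : ∃ ν, h.coeff ν ≠ 0 ∧
      ∀ l, v (i (h.coeff l)) * γ ^ l ≤ v (i (h.coeff ν)) * γ ^ ν := by
  obtain ⟨ν, hν, hmax⟩ := h.support.exists_max_image (fun l => v (i (h.coeff l)) * γ ^ l)
    (nonempty_support_iff.2 hh)
  refine ⟨ν, mem_support_iff.1 hν, fun l => ?_⟩
  by_cases hl : h.coeff l = 0
  · simp [hl]
  · exact hmax l (mem_support_iff.2 hl)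

namespace CoarselyHenselian

variable (hv : CoarselyHenselian v)
include hv

theorem exists_between (lo hi : Finset K) (hlo : ∀ x ∈ lo, x ≠ 0) (hhi : ∀ x ∈ hi, x ≠ 0)
    (h : ∀ x ∈ lo, ∀ y ∈ hi, v x < v y) :
    ∃ z, z ≠ 0 ∧ (∀ x ∈ lo, v x < v z) ∧ ∀ y ∈ hi, v z < v y := by
  obtain ⟨ε, hε, hε1⟩ := hv.exists_lt_one
  rcases lo.eq_empty_or_nonempty with rfl | nlo
  · rcases hi.eq_empty_or_nonempty with rfl | nhi
    · exact ⟨1, by simp⟩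
    · obtain ⟨y, hy, hmin⟩ := hi.exists_min_image v nhi
      refine ⟨y * ε, mul_ne_zero (hhi y hy) hε, by simp, fun y' hy' => lt_of_lt_of_le ?_ (hmin _ hy')⟩
      rw [map_mul]
      exact mul_lt_of_lt_one_right (zero_lt_iff.2 (by simpa using hhi y hy)) hε1
  · obtain ⟨x, hx, hmax⟩ := lo.exists_max_image v nlo
    have hx0 : 0 < v x := zero_lt_iff.2 (by simpa using hlo x hx)
    rcases hi.eq_empty_or_nonempty with rfl | nhi
    · refine ⟨x / ε, div_ne_zero (hlo x hx) hε, fun x' hx' => lt_of_le_of_lt (hmax _ hx') ?_, by simp⟩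
      rw [map_div₀, lt_div_iff₀ (zero_lt_iff.2 (by simpa using hε))]
      exact mul_lt_of_lt_one_right hx0 hε1
    · obtain ⟨y, hy, hmin⟩ := hi.exists_min_image v nhi
      have hxy := h x hx y hy
      obtain ⟨q, hq, z, hz⟩ := hv.exists_pow_eq 2 two_pos (x * y) (mul_ne_zero (hlo x hx) (hhi y hy))
      have hvz : v z ^ 2 = v x * v y := by
        rw [← map_pow, hz, hv.map_natCast_mul q hq, map_mul]
      have h1 : v x < v z := by
        rw [← pow_lt_pow_iff_left₀ zero_le zero_le two_ne_zero, hvz, pow_two]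
        exact mul_lt_mul_of_pos_left hxy hx0
      have h2 : v z < v y := by
        rw [← pow_lt_pow_iff_left₀ zero_le zero_le two_ne_zero, hvz, pow_two]
        exact mul_lt_mul_of_pos_right hxy (hx0.trans hxy)
      refine ⟨z, ?_, fun x' hx' => (hmax _ hx').trans_lt h1, fun y' hy' => h2.trans_le (hmin _ hy')⟩
      rintro rfl
      simp at h1

theorem exists_powEquiv_map_eq {n : ℕ} (hn : 0 < n) {x z : K} (hx : x ≠ 0) (hz : z ≠ 0) :
    ∃ x', x' ≠ 0 ∧ v x' = v z ∧ PowEquiv n x x' := by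
  obtain ⟨q, hq, y, hy⟩ := hv.exists_pow_eq n hn (x / z) (div_ne_zero hx hz)
  have := hv.charZero
  have hq' : (q : K) ≠ 0 := by exact_mod_cast hq
  refine ⟨z / q, div_ne_zero hz hq', by rw [map_div₀, hv.map_natCast q hq, div_one], y, ?_, ?_⟩
  · rintro rfl
    rw [zero_pow hn.ne'] at hy
    exact mul_ne_zero hq' (div_ne_zero hx hz) hy.symm
  · rw [hy]; field_simp

variable {F : Type*} [Field F] {i j : F →+* K}
  (hij : ∀ n : ℕ, 0 < n → ∀ x, PowEquiv n (i x) (j x)) {d : ℕ}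
  (hcl : ∀ h : F[X], h ≠ 0 → h.natDegree < d → ∀ β, h.eval₂ i β = 0 → β ∈ i.range)
include hij hcl

omit hij in
theorem exists_dominant {h : F[X]} (hh : h ≠ 0) (hd : h.natDegree < d) {γ : Γ₀} (hγ0 : γ ≠ 0)
    (hγ : ∀ e, v (i e) ≠ γ) : ∃ ν, h.coeff ν ≠ 0 ∧
      ∀ l, l ≠ ν → v (i (h.coeff l)) * γ ^ l < v (i (h.coeff ν)) * γ ^ ν := by
  obtain ⟨ν, hν, hmax⟩ := Valuation.exists_max_term (v := v) i hh (γ := γ)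
  refine ⟨ν, hν, fun l hl => lt_of_le_of_ne (hmax l) fun heq => ?_⟩
  have hνd := le_natDegree_of_ne_zero hν
  have hl0 : h.coeff l ≠ 0 := by
    intro h0
    rw [h0, map_zero, map_zero, zero_mul, eq_comm] at heq
    exact mul_ne_zero (by simpa using hν) (pow_ne_zero _ hγ0) heq
  have hld := le_natDegree_of_ne_zero hl0
  rcases lt_or_gt_of_ne hl with h | h
  · exact hv.map_mul_pow_ne hcl hγ0 hγ h (by omega) hl0 hν heq
  · exact hv.map_mul_pow_ne hcl hγ0 hγ h (by omega) hν hl0 heq.symm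

theorem exists_match {b : K} (hb : b ∉ i.range) (s : Finset F[X])
    (hs : ∀ g ∈ s, g.natDegree < d) {n : ℕ} (hn : 0 < n) :
    ∃ b' : K, ∀ g ∈ s, PowEquiv n (g.eval₂ i b) (g.eval₂ j b') := by
  classical
  obtain ⟨c, hc⟩ := hv.exists_centre hcl hb s hs
  have hx0 : b - i c ≠ 0 := by
    rw [sub_ne_zero]; rintro rfl; exact hb ⟨c, rfl⟩
  have hev : ∀ (k : F →+* K) (y : K) (g : F[X]), g.eval₂ k (k c + y) = (taylor c g).eval₂ k y :=
    fun k y g => by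
      rw [← eval_map, ← eval_map, map_taylor, taylor_eval, add_comm]
  have hbx : b = i c + (b - i c) := by ring
  set x := b - i c with hx
  by_cases hγ : ∃ e, v (i e) = v x
  · obtain ⟨e, he⟩ := hγ
    have he0 : i e ≠ 0 := by
      rw [← Valuation.ne_zero_iff v, he]; simpa using hx0
    refine ⟨j c + j e * (x / i e), fun g hg => ?_⟩
    have hxe : x = i e * (x / i e) := by field_simp
    have hu : v (x / i e) = 1 := by rw [map_div₀, he, div_self (by simpa using hx0)]
    have hcg := hc g hg
    rw [hbx, hev] at hcg ⊢
    rw [hev]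
    conv at hcg => enter [l, 2]; rw [hxe]
    conv => enter [2]; rw [hxe]
    refine hv.powEquiv_eval₂_of_unit hij hu.le (by simp) (fun l => ?_) hn
    rw [he]
    exact hcg l
  · push Not at hγ
    have hγ0 : v x ≠ 0 := by simpa using hx0
    have hex : ∀ (y z : F) (m : ℕ), ∃ e : F, y ≠ 0 → z ≠ 0 → 0 < m → m < d →
        e ≠ 0 ∧ v (i y) = v (i z) * v (i e) ^ m := by
      intro y z m
      by_cases h : y ≠ 0 ∧ z ≠ 0 ∧ 0 < m ∧ m < d
      · obtain ⟨e, he⟩ := hv.exists_map_eq_mul_pow hcl h.2.2.1 h.2.2.2 h.1 h.2.1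
        exact ⟨e, fun _ _ _ _ => he⟩
      · exact ⟨0, fun h1 h2 h3 h4 => absurd ⟨h1, h2, h3, h4⟩ h⟩
    choose E hE using hex
    set T : Finset F := s.biUnion fun g => (Finset.range d ×ˢ Finset.range d).image fun q =>
      E ((taylor c g).coeff q.1) ((taylor c g).coeff q.2) (q.2 - q.1) with hT
    have hmemT : ∀ g ∈ s, ∀ l k, l < d → k < d →
        E ((taylor c g).coeff l) ((taylor c g).coeff k) (k - l) ∈ T := fun g hg l k hl hk =>
      Finset.mem_biUnion.2 ⟨g, hg, Finset.mem_image.2 ⟨(l, k), by simp [hl, hk], rfl⟩⟩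
    set lo : Finset F := T.filter fun e => e ≠ 0 ∧ v (i e) < v x
    set hi : Finset F := T.filter fun e => e ≠ 0 ∧ v x < v (i e)
    obtain ⟨z, hz0, hzlo, hzhi⟩ := hv.exists_between (lo.image j) (hi.image j)
      (by
        intro y hy
        obtain ⟨w, hw, rfl⟩ := Finset.mem_image.1 hy
        simpa using (Finset.mem_filter.1 hw).2.1) (by
        intro y hy
        obtain ⟨w, hw, rfl⟩ := Finset.mem_image.1 hy
        simpa using (Finset.mem_filter.1 hw).2.1) (by
        intro y hy z hz
        obtain ⟨w, hw, rfl⟩ := Finset.mem_image.1 hy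
        obtain ⟨w', hw', rfl⟩ := Finset.mem_image.1 hz
        rw [← hv.map_lt_map_iff hij]
        exact (Finset.mem_filter.1 hw).2.2.trans (Finset.mem_filter.1 hw').2.2)
    obtain ⟨x', hx'0, hx'z, hxx'⟩ := hv.exists_powEquiv_map_eq hn hx0 hz0
    rw [← hx'z] at hzlo hzhi
    have hγ'0 : v x' ≠ 0 := by simpa using hx'0
    refine ⟨j c + x', fun g hg => ?_⟩
    rw [hbx, hev, hev]
    rcases eq_or_ne g 0 with rfl | hg0
    · simpa using PowEquiv.refl n (0 : K)
    set h := taylor c g with hh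
    have hdeg : h.natDegree < d := by rw [hh, natDegree_taylor]; exact hs g hg
    obtain ⟨ν, hν, hdom⟩ := hv.exists_dominant hcl (by rwa [hh, Ne, taylor_eq_zero]) hdeg hγ0 hγ
    refine hv.powEquiv_eval₂_of_dominant hij hn hxx' hdom fun l hl => ?_
    have hνd := le_natDegree_of_ne_zero hν
    rcases eq_or_ne (h.coeff l) 0 with hl0 | hl0
    · rw [hl0, map_zero, map_zero, zero_mul, zero_lt_iff]
      exact mul_ne_zero (by simpa using hν) (pow_ne_zero _ hγ'0)
    have hld := le_natDegree_of_ne_zero hl0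
    have hlt := hdom l hl
    have htransfer : ∀ {a b e : F} {m : ℕ}, v (i a) = v (i b) * v (i e) ^ m →
        v (j a) = v (j b) * v (j e) ^ m := by
      intro a b e m h
      rw [← map_pow, ← map_pow, ← map_mul, ← map_mul] at h ⊢
      exact (hv.map_eq_map_iff hij).1 h
    rcases lt_or_gt_of_ne hl with hlν | hlν
    · obtain ⟨he0, he⟩ := hE _ _ (ν - l) hl0 hν (by omega) (by omega)
      have hmem := hmemT g hg l ν (by omega) (by omega)
      rw [he] at hlt
      rw [htransfer he]
      rw [mul_pow_mul_lt_iff (by simpa using hν) hγ0 hlν] at hlt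
      rw [mul_pow_mul_lt_iff (by simpa using hν) hγ'0 hlν]
      exact hzlo _ (Finset.mem_image_of_mem _ (Finset.mem_filter.2 ⟨hmem, he0, hlt⟩))
    · obtain ⟨he0, he⟩ := hE _ _ (l - ν) hν hl0 (by omega) (by omega)
      have hmem := hmemT g hg ν l (by omega) (by omega)
      rw [he] at hlt
      rw [htransfer he]
      rw [mul_lt_mul_pow_mul_iff (by simpa using hl0) hγ0 hlν] at hlt
      rw [mul_lt_mul_pow_mul_iff (by simpa using hl0) hγ'0 hlν]
      exact hzhi _ (Finset.mem_image_of_mem _ (Finset.mem_filter.2 ⟨hmem, he0, hlt⟩))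

end CoarselyHenselian
end Coarse

section Coarse

open Polynomial

variable {K Γ₀ : Type*} [Field K] [LinearOrderedCommGroupWithZero Γ₀] {v : Valuation K Γ₀}

theorem Valuation.taylor_coeff_le_one {G : K[X]} (hG : ∀ l, v (G.coeff l) ≤ 1) {x : K}
    (hx : v x ≤ 1) (l : ℕ) : v ((taylor x G).coeff l) ≤ 1 := by
  simpa using Valuation.taylor_coeff_le (v := v) (G := G) (c := 0) (γ := 1) (M := 1) (i := 0)
    (by simpa using hx) (fun l _ => by simpa using hG l) l l.zero_le

namespace CoarselyHenselian

variable (hv : CoarselyHenselian v)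
include hv

theorem exists_root_near_of_le_one {G : K[X]} (hG : ∀ l, v (G.coeff l) ≤ 1) {x : K} (hx : v x ≤ 1)
    (h0 : v (G.eval x) < 1) (h1 : v (G.derivative.eval x) = 1) :
    ∃ β, G.eval β = 0 ∧ v (β - x) < 1 := by
  obtain ⟨β, hβ, h⟩ := hv.exists_root_near (G := G) (x := x) (γ := 1)
    (fun l _ => by simpa [h1] using Valuation.taylor_coeff_le_one hG hx l) (by simpa [h1] using h0)
  exact ⟨β, hβ, by rw [h1, mul_one] at h; rwa [h]⟩

theorem map_coeff_derivative {F : Type*} [Field F] (i : F →+* K) (h : F[X]) (l : ℕ) :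
    v (i (h.derivative.coeff l)) = v (i (h.coeff (l + 1))) := by
  rw [coeff_derivative, ← Nat.cast_succ, map_mul i, _root_.map_natCast, mul_comm (i _),
    hv.map_natCast_mul _ l.succ_ne_zero]

variable {F : Type*} [Field F] {i j : F →+* K}
  (hij : ∀ n : ℕ, 0 < n → ∀ x, PowEquiv n (i x) (j x))
include hij

theorem exists_root_of_unit {h : F[X]} (hh : h ≠ 0) {e : F} (he : e ≠ 0) {u : K} (hu : v u = 1)
    (h0 : h.eval₂ i (i e * u) = 0)
    (h1 : ∀ l, v (i (h.derivative.coeff l)) * v (i e) ^ l ≤ v (h.derivative.eval₂ i (i e * u))) :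
    ∃ u', v (u - u') < 1 ∧ h.eval₂ j (j e * u') = 0 := by
  obtain ⟨ν, hν, hmax⟩ := Valuation.exists_max_term (v := v) i hh (γ := v (i e))
  set A := h.coeff ν * e ^ ν with hA
  have hA0 : A ≠ 0 := mul_ne_zero hν (pow_ne_zero _ he)
  have hvA : v (i A) ≠ 0 := by simpa using hA0
  set H := C A⁻¹ * h.comp (C e * X) with hH
  have hcoeff : ∀ l, v (i (H.coeff l)) = (v (i A))⁻¹ * (v (i (h.coeff l)) * v (i e) ^ l) := by
    intro l
    rw [hH, coeff_C_mul, comp_C_mul_X_coeff]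
    simp
  have hH1 : ∀ l, v (i (H.coeff l)) ≤ 1 := fun l => by
    rw [hcoeff, inv_mul_le_one₀ (zero_lt_iff.2 hvA), hA]
    simpa using hmax l
  have hHu : H.eval₂ i u = 0 := by rw [hH, eval₂_rescale, h0, mul_zero]
  obtain ⟨l, hl⟩ : ∃ l, 1 ≤ v (i (H.coeff (l + 1))) := by
    by_contra! hcon
    rcases ν with _ | ν
    · have h2 : H.coeff 0 = 1 := by
        rw [hH, coeff_C_mul, comp_C_mul_X_coeff, ← hA, inv_mul_cancel₀ hA0]
      have h3 : v (((H - 1).map i).eval u) < 1 := by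
        refine Valuation.eval_lt one_ne_zero fun l => ?_
        rcases l with _ | l
        · simp [h2]
        · simpa [hu, coeff_one] using hcon l
      rw [eval_map, eval₂_sub, hHu, eval₂_one, zero_sub, Valuation.map_neg, map_one] at h3
      exact lt_irrefl _ h3
    · have := hcon ν
      rw [hcoeff, inv_mul_lt_one₀ (zero_lt_iff.2 hvA), hA] at this
      simp at this
  have hder : H.derivative = C (A⁻¹ * e) * h.derivative.comp (C e * X) := by
    rw [hH, derivative_C_mul, derivative_comp, derivative_C_mul, derivative_X, mul_one, C_mul]
    ring
  have hd1 : ∀ l, v (i (H.derivative.coeff l)) ≤ 1 := fun l => by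
    rw [hv.map_coeff_derivative]
    exact hH1 _
  have hdu : v (H.derivative.eval₂ i u) = 1 := by
    refine le_antisymm ?_ ?_
    · rw [← eval_map]
      exact Valuation.eval_le fun l => by simpa [hu] using hd1 l
    · rw [hder, eval₂_rescale, map_mul]
      refine le_trans hl ?_
      refine le_trans ?_ (mul_le_mul_right (h1 l) _)
      rw [hv.map_coeff_derivative, hcoeff, map_mul i A⁻¹, map_mul v, map_inv₀, map_inv₀, pow_succ]
      apply le_of_eq
      ac_rfl
  have hsub0 := hv.eval₂_sub_lt_one hij hH1 hu.le (u' := u) (by simp)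
  have hsub1 := hv.eval₂_sub_lt_one hij hd1 hu.le (u' := u) (by simp)
  obtain ⟨β, hβ, hβu⟩ := hv.exists_root_near_of_le_one (G := H.map j) (x := u) (fun l => by
      rw [coeff_map]
      exact Valuation.map_le_one_of_sub (hH1 l) (hv.map_sub_map_lt_one hij (hH1 l))) hu.le
    (by rwa [hHu, zero_sub, Valuation.map_neg, ← eval_map] at hsub0)
    (by
      rw [derivative_map, eval_map, ← hdu]
      refine v.map_eq_of_sub_lt ?_
      rwa [v.map_sub_swap, hdu])
  refine ⟨β, by rwa [v.map_sub_swap], ?_⟩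
  rw [eval_map, hH, eval₂_rescale] at hβ
  exact (mul_eq_zero.1 hβ).resolve_left (by simpa using hA0)

theorem map_mul_pow_lt_of_lt {d : ℕ} (hd : d ≠ 0) {w : F} {γ γ' : Γ₀} (hw : v (i w) = γ ^ d)
    (hw' : v (j w) = γ' ^ d) {a b : F} {l k : ℕ} (h : v (i a) * γ ^ l < v (i b) * γ ^ k) :
    v (j a) * γ' ^ l < v (j b) * γ' ^ k := by
  have key : ∀ (f : F →+* K) (γ : Γ₀), v (f w) = γ ^ d → ∀ a l,
      (v (f a) * γ ^ l) ^ d = v (f (a ^ d * w ^ l)) := by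
    intro f γ hw a l
    simp only [map_mul, map_pow, hw]
    rw [mul_pow, ← pow_mul, ← pow_mul, mul_comm l]
  rw [← pow_lt_pow_iff_left₀ zero_le zero_le hd, key i γ hw, key i γ hw,
    hv.map_lt_map_iff hij] at h
  rwa [← pow_lt_pow_iff_left₀ zero_le zero_le hd, key j γ' hw', key j γ' hw']

variable {d : ℕ}
  (hcl : ∀ h : F[X], h ≠ 0 → h.natDegree < d → ∀ β, h.eval₂ i β = 0 → β ∈ i.range)
include hcl

omit hij in
/-- At a root of new valuation, the extreme terms of the polynomial are the dominant ones. -/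
theorem coeff_of_root {h : F[X]} (hd : h.natDegree = d) (hd0 : 0 < d) {x : K} (hx : x ≠ 0)
    (hγ : ∀ e, v (i e) ≠ v x) (h0 : h.eval₂ i x = 0) :
    v (i (h.coeff 0)) = v (i (h.coeff d)) * v x ^ d ∧
      ∀ l, l ≠ 0 → l ≠ d → v (i (h.coeff l)) * v x ^ l < v (i (h.coeff 0)) := by
  have hh : h ≠ 0 := by rintro rfl; simp at hd; omega
  have hγ0 : v x ≠ 0 := by simpa using hx
  have hlead : h.coeff d ≠ 0 := by rw [← hd]; simpa using hh
  obtain ⟨ν, hν, hmax⟩ := Valuation.exists_max_term (v := v) i hh (γ := v x)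
  have hM : v (i (h.coeff ν)) * v x ^ ν ≠ 0 := mul_ne_zero (by simpa using hν) (pow_ne_zero _ hγ0)
  have hνd : ν ≤ d := hd ▸ le_natDegree_of_ne_zero hν
  obtain ⟨l, hlν, hl⟩ : ∃ l, l ≠ ν ∧
      v (i (h.coeff l)) * v x ^ l = v (i (h.coeff ν)) * v x ^ ν := by
    by_contra! hcon
    have h1 := hv.powEquiv_eval_of_dominant (G := h.map i) (x := x) (ν := ν)
      (fun l hl => by simpa using lt_of_le_of_ne (hmax l) (hcon l hl)) one_pos
    rw [eval_map, h0] at h1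
    have := h1.eq_zero_iff.1 rfl
    rw [coeff_map] at this
    exact mul_ne_zero (by simpa using hν) (pow_ne_zero _ hx) this
  have hl0 : h.coeff l ≠ 0 := by
    intro h0
    rw [h0, map_zero, map_zero, zero_mul] at hl
    exact hM hl.symm
  have hld : l ≤ d := hd ▸ le_natDegree_of_ne_zero hl0
  have hpair : (l = 0 ∧ ν = d) ∨ (l = d ∧ ν = 0) := by
    by_contra hcon
    rcases lt_or_gt_of_ne hlν with hlt | hlt
    · exact hv.map_mul_pow_ne hcl hγ0 hγ hlt (by omega) hl0 hν hl
    · exact hv.map_mul_pow_ne hcl hγ0 hγ hlt (by omega) hν hl0 hl.symm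
  have hends : v (i (h.coeff 0)) = v (i (h.coeff d)) * v x ^ d ∧ h.coeff 0 ≠ 0 ∧
      ∀ l, v (i (h.coeff l)) * v x ^ l ≤ v (i (h.coeff 0)) := by
    rcases hpair with ⟨rfl, rfl⟩ | ⟨rfl, rfl⟩
    · rw [pow_zero, mul_one] at hl
      exact ⟨hl, hl0, fun l => hl ▸ hmax l⟩
    · rw [pow_zero, mul_one] at hl hmax
      exact ⟨hl.symm, hν, hmax⟩
  refine ⟨hends.1, fun l hl hld => lt_of_le_of_ne (hends.2.2 l) fun heq => ?_⟩
  have hl0 : h.coeff l ≠ 0 := by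
    intro h0
    rw [h0, map_zero, map_zero, zero_mul, eq_comm, map_eq_zero, map_eq_zero] at heq
    exact hends.2.1 heq
  have hld' : l ≤ d := hd ▸ le_natDegree_of_ne_zero hl0
  refine hv.map_mul_pow_ne hcl hγ0 hγ (Nat.pos_of_ne_zero hl) (by omega) hends.2.1 hl0 ?_
  rw [pow_zero, mul_one, heq]

theorem exists_root_of_new_value {h : F[X]} (hd : h.natDegree = d) (hd0 : 0 < d) {x : K}
    (hx : x ≠ 0) (hγ : ∀ e, v (i e) ≠ v x) (h0 : h.eval₂ i x = 0) {n : ℕ} (hn : 0 < n) :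
    ∃ x', h.eval₂ j x' = 0 ∧
      ∀ g : F[X], g.natDegree < d → PowEquiv n (g.eval₂ i x) (g.eval₂ j x') := by
  have hh : h ≠ 0 := by rintro rfl; simp at hd; omega
  have hγ0 : v x ≠ 0 := by simpa using hx
  have hlead : h.coeff d ≠ 0 := by rw [← hd]; simpa using hh
  obtain ⟨hend, hmid⟩ := hv.coeff_of_root hcl hd hd0 hx hγ h0
  have hconst : h.coeff 0 ≠ 0 := by
    intro h
    rw [h, map_zero, map_zero] at hend
    exact mul_ne_zero (by simpa using hlead) (pow_ne_zero _ hγ0) hend.symm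
  set w := -h.coeff 0 / h.coeff d with hw
  have hvw : v (i w) = v x ^ d := by
    rw [hw, map_div₀, map_neg, map_div₀, Valuation.map_neg, hend, mul_div_cancel_left₀]
    simpa using hlead
  have hwx : v (i w - x ^ d) < v (x ^ d) := by
    have h1 : i w - x ^ d =
        ((h - C (h.coeff 0) - monomial d (h.coeff d)).map i).eval x / i (h.coeff d) := by
      have : i (h.coeff d) ≠ 0 := by simpa using hlead
      rw [eval_map, eval₂_sub, eval₂_sub, h0, eval₂_C, eval₂_monomial, hw, map_div₀, map_neg]
      field_simp
      ring
    rw [h1, map_div₀, div_lt_iff₀ (zero_lt_iff.2 (by simpa using hlead)), map_pow,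
      mul_comm, ← hend]
    refine Valuation.eval_lt (by simpa using hconst) fun l => ?_
    rcases eq_or_ne l 0 with rfl | hl
    · simp [coeff_monomial, hd0.ne']
      exact zero_lt_iff.2 (by simpa using hconst)
    rcases eq_or_ne l d with rfl | hld
    · simp [coeff_C, hd0.ne']
      exact zero_lt_iff.2 (by simpa using hconst)
    simpa [coeff_C, coeff_monomial, hl, hld.symm] using hmid l hl hld
  obtain ⟨y, hy, hjw⟩ := (hij (n * d) (by positivity) w).symm.trans
    (hv.powEquiv_of_sub_lt (Nat.mul_pos hn hd0) hwx)
  rw [pow_mul, ← mul_pow] at hjw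
  set z := x * y ^ n with hz
  have hz0 : z ≠ 0 := mul_ne_zero hx (pow_ne_zero _ hy)
  have hxz : PowEquiv n x z := PowEquiv.symm ⟨y, hy, rfl⟩
  have hvw' : v (j w) = v z ^ d := by rw [hjw, map_pow]
  have htransfer : ∀ {a b : F} {l k : ℕ}, v (i a) * v x ^ l < v (i b) * v x ^ k →
      v (j a) * v z ^ l < v (j b) * v z ^ k := hv.map_mul_pow_lt_of_lt hij hd0.ne' hvw hvw'
  have hj0 : j (h.coeff 0) ≠ 0 := by simpa using hconst
  have hjd : j (h.coeff d) ≠ 0 := by simpa using hlead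
  set H := C (j (h.coeff 0))⁻¹ * (h.map j).comp (C z * X) with hH
  set P := H - 1 + X ^ d with hP
  have hHcoeff : ∀ l, H.coeff l = (j (h.coeff 0))⁻¹ * (j (h.coeff l) * z ^ l) := fun l => by
    rw [hH, coeff_C_mul, comp_C_mul_X_coeff, coeff_map]
  have hPcoeff : ∀ l, v (P.coeff l) < 1 := by
    intro l
    rw [hP, coeff_add, coeff_sub, hHcoeff, coeff_one, coeff_X_pow]
    rcases eq_or_ne l 0 with rfl | hl
    · simp [hd0.ne, hconst]
    rcases eq_or_ne l d with rfl | hld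
    · rw [← hjw, hw, map_div₀, map_neg, mul_div_cancel₀ _ hjd, mul_neg, inv_mul_cancel₀ hj0]
      simp [hl]
    simp only [hl, hld, if_false, sub_zero, add_zero, map_mul, map_inv₀, map_pow]
    rw [inv_mul_lt_one₀ (zero_lt_iff.2 (by simpa using hconst))]
    simpa using htransfer (b := h.coeff 0) (k := 0) (by simpa using hmid l hl hld)
  have hHP : H = P + 1 - X ^ d := by rw [hP]; ring
  have hH1 : v (H.eval 1) < 1 := by
    rw [hHP]
    simpa using Valuation.eval_lt (G := P) (u := 1) one_ne_zero (by simpa using hPcoeff)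
  have hH' : v (H.derivative.eval 1) = 1 := by
    rw [← hv.map_natCast d hd0.ne', ← Valuation.map_neg v (d : K)]
    refine v.map_eq_of_sub_lt ?_
    rw [Valuation.map_neg, hv.map_natCast d hd0.ne']
    have : H.derivative.eval 1 - -(d : K) = P.derivative.eval 1 := by
      rw [hHP]; simp [derivative_X_pow]
    rw [this]
    refine Valuation.eval_lt one_ne_zero fun l => ?_
    rw [coeff_derivative, ← Nat.cast_succ, mul_comm (P.coeff _),
      hv.map_natCast_mul _ l.succ_ne_zero]
    simpa using hPcoeff (l + 1)
  obtain ⟨u, hu, hu1⟩ := hv.exists_root_near_of_le_one (G := H) (x := 1) (fun l => by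
    rw [hHP, coeff_sub, coeff_add, coeff_one, coeff_X_pow]
    refine v.map_sub_le (v.map_add_le (hPcoeff l).le ?_) ?_ <;> split_ifs <;> simp) (by simp) hH1 hH'
  have hvu : v u = 1 := by
    rw [v.map_eq_of_sub_lt (y := u) (x := 1) (by simpa using hu1), map_one]
  have hxu : PowEquiv n x (z * u) := by
    have := hxz.mul (hv.powEquiv_of_sub_lt hn (x := u) (y := 1) (by simpa using hu1)).symm
    rwa [mul_one] at this
  refine ⟨z * u, ?_, fun g hg => ?_⟩
  · rw [hH, eval_mul, eval_C, eval_comp, eval_mul, eval_C, eval_X, eval_map] at hu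
    exact (mul_eq_zero.1 hu).resolve_left (inv_ne_zero hj0)
  · rcases eq_or_ne g 0 with rfl | hg0
    · simpa using PowEquiv.refl n (0 : K)
    obtain ⟨ν, -, hdom⟩ := hv.exists_dominant hcl hg0 hg hγ0 hγ
    refine hv.powEquiv_eval₂_of_dominant hij hn hxu hdom fun l hl => ?_
    rw [map_mul, hvu, mul_one]
    exact htransfer (hdom l hl)

theorem exists_match_root {f : F[X]} (hd : f.natDegree = d) (hd0 : 0 < d) {b : K}
    (hb : b ∉ i.range) (hf : f.eval₂ i b = 0) (s : Finset F[X]) (hs : ∀ g ∈ s, g.natDegree < d)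
    {n : ℕ} (hn : 0 < n) :
    ∃ b' : K, f.eval₂ j b' = 0 ∧ ∀ g ∈ s, PowEquiv n (g.eval₂ i b) (g.eval₂ j b') := by
  classical
  have hder : f.derivative.natDegree < d := by
    rw [← hd]; exact natDegree_derivative_lt (by omega)
  obtain ⟨c, hc⟩ := hv.exists_centre hcl hb (insert f.derivative s) (by
    intro g hg
    rcases Finset.mem_insert.1 hg with rfl | hg
    exacts [hder, hs g hg])
  have hx0 : b - i c ≠ 0 := by
    rw [sub_ne_zero]; rintro rfl; exact hb ⟨c, rfl⟩
  have hev : ∀ (k : F →+* K) (y : K) (g : F[X]), g.eval₂ k (k c + y) = (taylor c g).eval₂ k y :=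
    fun k y g => by
      rw [← eval_map, ← eval_map, map_taylor, taylor_eval, add_comm]
  have hbx : b = i c + (b - i c) := by ring
  set x := b - i c with hx
  rw [hbx, hev] at hf
  by_cases hγ : ∃ e, v (i e) = v x
  · obtain ⟨e, he⟩ := hγ
    have he0 : i e ≠ 0 := by
      rw [← Valuation.ne_zero_iff v, he]; simpa using hx0
    have hxe : x = i e * (x / i e) := by field_simp
    have hu : v (x / i e) = 1 := by rw [map_div₀, he, div_self (by simpa using hx0)]
    have hc' : ∀ g ∈ insert f.derivative s, ∀ l, v (i ((taylor c g).coeff l)) * v (i e) ^ l ≤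
        v ((taylor c g).eval₂ i (i e * (x / i e))) := by
      intro g hg l
      rw [← hxe, ← hev, ← hbx, he]
      exact hc g hg l
    rw [hxe] at hf
    have hf0 : f ≠ 0 := by rintro rfl; simp at hd; omega
    obtain ⟨u', hu', hroot⟩ := hv.exists_root_of_unit hij (h := taylor c f)
      (by rwa [Ne, taylor_eq_zero]) (by simpa using he0) hu hf (by
        have : (taylor c f).derivative = taylor c f.derivative := by
          simp [taylor_apply, derivative_comp]
        rw [this]
        exact hc' _ (Finset.mem_insert_self _ _))
    refine ⟨j c + j e * u', by rw [hev, hroot], fun g hg => ?_⟩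
    rw [hbx, hev, hev]
    conv => enter [2]; rw [hxe]
    exact hv.powEquiv_eval₂_of_unit hij hu.le hu' (hc' g (Finset.mem_insert_of_mem hg)) hn
  · push Not at hγ
    obtain ⟨x', hx', hmatch⟩ := hv.exists_root_of_new_value hij hcl
      (h := taylor c f) (by rw [natDegree_taylor, hd]) hd0 hx0 hγ hf hn
    refine ⟨j c + x', by rw [hev, hx'], fun g hg => ?_⟩
    rw [hbx, hev, hev]
    exact hmatch _ (by rw [natDegree_taylor]; exact hs g hg)

end CoarselyHenselian
end Coarse

section PartialIsomorphism

open Polynomial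

universe u

variable {K : Type u} [Field K]

theorem PowEquiv.inv {n : ℕ} {x y : K} (h : PowEquiv n x y) : PowEquiv n x⁻¹ y⁻¹ := by
  obtain ⟨z, hz, rfl⟩ := h
  exact ⟨z⁻¹, inv_ne_zero hz, by rw [mul_inv, inv_pow]⟩

/-- The graph of a partial map respecting the classes modulo powers. -/
def RespectsPowers (S : Subring (K × K)) : Prop :=
  ∀ z ∈ S, ∀ n : ℕ, 0 < n → PowEquiv n z.1 z.2

theorem RespectsPowers.mem_of_maximal {S : Subring (K × K)} (hS : Maximal RespectsPowers S)
    (β : K × K) (h : ∀ g : S[X], ∀ n : ℕ, 0 < n →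
      PowEquiv n (g.eval₂ ((RingHom.fst K K).comp S.subtype) β.1)
        (g.eval₂ ((RingHom.snd K K).comp S.subtype) β.2)) : β ∈ S := by
  have hle : S ≤ (eval₂RingHom S.subtype β).range := fun z hz => ⟨C ⟨z, hz⟩, by simp⟩
  refine hS.2 (y := (eval₂RingHom S.subtype β).range) ?_ hle ⟨X, by simp⟩
  rintro _ ⟨g, rfl⟩ n hn
  have h1 := hom_eval₂ g S.subtype (RingHom.fst K K) β
  have h2 := hom_eval₂ g S.subtype (RingHom.snd K K) β
  simp only [RingHom.coe_fst, RingHom.coe_snd] at h1 h2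
  rw [coe_eval₂RingHom, h1, h2]
  exact h g n hn

theorem RespectsPowers.isField_of_maximal {S : Subring (K × K)}
    (hS : Maximal RespectsPowers S) : IsField S := by
  refine ⟨⟨0, 1, zero_ne_one⟩, mul_comm, fun {a} ha => ?_⟩
  have h1 : a.1.1 = 0 ↔ a.1.2 = 0 := (hS.1 a.1 a.2 1 one_pos).eq_zero_iff
  have h10 : a.1.1 ≠ 0 := fun h => ha (Subtype.ext (Prod.ext h (h1.1 h)))
  have h20 : a.1.2 ≠ 0 := fun h => h10 (h1.2 h)
  refine ⟨⟨(a.1.1⁻¹, a.1.2⁻¹), RespectsPowers.mem_of_maximal hS _ fun g n hn => ?_⟩,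
    Subtype.ext (Prod.ext (mul_inv_cancel₀ h10) (mul_inv_cancel₀ h20))⟩
  have key : ∀ (k : S →+* K), k a ≠ 0 →
      g.eval₂ k (k a)⁻¹ = k (g.reverse.eval a) * (k a)⁻¹ ^ g.natDegree := by
    intro k hk
    let _ : Invertible (k a)⁻¹ := invertibleOfNonzero (inv_ne_zero hk)
    rw [← eval₂_reverse_mul_pow k (k a)⁻¹ g, invOf_eq_inv, inv_inv, eval₂_at_apply]
  rw [show a.1.1⁻¹ = ((RingHom.fst K K).comp S.subtype a)⁻¹ from rfl,
    show a.1.2⁻¹ = ((RingHom.snd K K).comp S.subtype a)⁻¹ from rfl, key _ h10, key _ h20]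
  exact (hS.1 _ (g.reverse.eval a).2 n hn).mul ((hS.1 _ a.2 n hn).inv.pow _)

theorem RespectsPowers.exists_maximal {R : Subring (K × K)} (hR : RespectsPowers R) :
    ∃ S, R ≤ S ∧ Maximal RespectsPowers S := by
  refine zorn_le_nonempty₀ {S | RespectsPowers S} (fun c hc hchain y hy => ?_) R hR
  refine ⟨sSup c, fun z hz n hn => ?_, fun z hz => le_sSup hz⟩
  obtain ⟨s, hs, hzs⟩ := (Subring.mem_sSup_of_directedOn ⟨y, hy⟩ hchain.directedOn).1 hz
  exact hc hs z hzs n hn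

/-- A correspondence respecting powers extends to a maximal isomorphism between subfields. -/
theorem RespectsPowers.exists_field {R : Subring (K × K)} (hR : RespectsPowers R) :
    ∃ (F : Type u) (_ : Field F) (i j : F →+* K),
      (∀ n : ℕ, 0 < n → ∀ x, PowEquiv n (i x) (j x)) ∧
      (∀ b b', (∀ g : F[X], ∀ n : ℕ, 0 < n → PowEquiv n (g.eval₂ i b) (g.eval₂ j b')) →
        b ∈ i.range) ∧
      ∀ z ∈ R, ∃ w, i w = z.1 ∧ j w = z.2 := by
  obtain ⟨S, hRS, hS⟩ := hR.exists_maximal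
  let _ := (isField_of_maximal hS).toField
  refine ⟨S, inferInstance, (RingHom.fst K K).comp S.subtype, (RingHom.snd K K).comp S.subtype,
    fun n hn x => hS.1 x x.2 n hn, fun b b' h => ?_, fun z hz => ⟨⟨z, hRS hz⟩, rfl, rfl⟩⟩
  exact ⟨⟨(b, b'), mem_of_maximal hS (b, b') h⟩, rfl⟩

variable {Γ₀ : Type*} [LinearOrderedCommGroupWithZero Γ₀] {v : Valuation K Γ₀}

theorem CoarselyHenselian.mem_range_of_root (hv : CoarselyHenselian v) {F : Type*} [Field F]
    {i j : F →+* K} (hij : ∀ n : ℕ, 0 < n → ∀ x, PowEquiv n (i x) (j x))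
    (hmax : ∀ b b', (∀ g : F[X], ∀ n : ℕ, 0 < n → PowEquiv n (g.eval₂ i b) (g.eval₂ j b')) →
      b ∈ i.range) (d : ℕ) :
    ∀ h : F[X], h ≠ 0 → h.natDegree < d → ∀ β, h.eval₂ i β = 0 → β ∈ i.range := by
  classical
  induction d with
  | zero => exact fun h _ hd => absurd hd (Nat.not_lt_zero _)
  | succ d ih =>
    intro h hh hd β hβ
    rcases Nat.lt_succ_iff_lt_or_eq.1 hd with hd | hd
    · exact ih h hh hd β hβ
    by_contra hb
    have hd0 : 0 < d := by
      rw [← hd]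
      refine natDegree_pos_of_eval₂_root hh i hβ fun x hx => ?_
      simpa using hx
    have hfail : ∀ b' : K, ∃ g : F[X], ∃ n : ℕ, 0 < n ∧
        ¬ PowEquiv n (g.eval₂ i β) (g.eval₂ j b') := by
      intro b'
      by_contra! hcon
      exact hb (hmax β b' hcon)
    choose g n hn hg using hfail
    have hmod : ∀ (k : F →+* K) (b : K), h.eval₂ k b = 0 → ∀ q : F[X],
        (q % h).eval₂ k b = q.eval₂ k b := by
      intro k b hb q
      conv_rhs => rw [← EuclideanDomain.mod_add_div q h, eval₂_add, eval₂_mul, hb, zero_mul,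
        add_zero]
    set R := (h.map j).roots.toFinset
    obtain ⟨b', hb', hmatch⟩ := hv.exists_match_root hij ih hd hd0 hb hβ
      (R.image fun r => g r % h) (by
        intro q hq
        obtain ⟨r, -, rfl⟩ := Finset.mem_image.1 hq
        exact hd ▸ natDegree_mod_lt _ (by omega)) (n := ∏ r ∈ R, n r)
      (Finset.prod_pos fun r _ => hn r)
    have hbR : b' ∈ R := by
      rw [Multiset.mem_toFinset, mem_roots (by rwa [Ne, Polynomial.map_eq_zero]), IsRoot, eval_map]
      exact hb'
    refine hg b' ?_
    have := (hmatch _ (Finset.mem_image_of_mem _ hbR)).of_dvd (Finset.dvd_prod_of_mem n hbR)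
    rwa [hmod i β hβ, hmod j b' hb'] at this

/-- Two tuples satisfy the same power conditions. -/
def SameType {ι : Type*} (a a' : ι → K) : Prop :=
  ∀ g : MvPolynomial ι ℤ, ∀ n : ℕ, 0 < n →
    PowEquiv n (MvPolynomial.aeval a g) (MvPolynomial.aeval a' g)

theorem CoarselyHenselian.exists_match_of_sameType (hv : CoarselyHenselian v) {ι : Type*}
    {a a' : ι → K} (h : SameType a a') (b : K) (s : Finset (MvPolynomial (Option ι) ℤ)) {n : ℕ}
    (hn : 0 < n) : ∃ b', ∀ g ∈ s, PowEquiv n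
      (MvPolynomial.aeval (fun o : Option ι => o.elim b a) g)
      (MvPolynomial.aeval (fun o : Option ι => o.elim b' a') g) := by
  classical
  set R : Subring (K × K) := ((MvPolynomial.aeval (fun k => (a k, a' k)) :
    MvPolynomial ι ℤ →ₐ[ℤ] K × K) : MvPolynomial ι ℤ →+* K × K).range
  have hR : RespectsPowers R := by
    rintro _ ⟨g, rfl⟩ n hn
    have h1 := MvPolynomial.comp_aeval (fun k => (a k, a' k)) (AlgHom.fst ℤ K K)
    have h2 := MvPolynomial.comp_aeval (fun k => (a k, a' k)) (AlgHom.snd ℤ K K)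
    have h1' := DFunLike.congr_fun h1 g
    have h2' := DFunLike.congr_fun h2 g
    simp only [AlgHom.coe_comp, Function.comp_apply, AlgHom.fst_apply, AlgHom.snd_apply] at h1' h2'
    rw [RingHom.coe_coe, h1', h2']
    exact h g n hn
  obtain ⟨S, _, i, j, hij, hmax, hRS⟩ := RespectsPowers.exists_field hR
  have hw : ∀ k, ∃ w, i w = a k ∧ j w = a' k := fun k =>
    hRS (a k, a' k) ⟨MvPolynomial.X k, by simp⟩
  choose w hwi hwj using hw
  let φ : MvPolynomial (Option ι) ℤ →+* S[X] :=
    MvPolynomial.eval₂Hom (Int.castRingHom _) (fun o => o.elim X fun k => C (w k))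
  have hφ : ∀ (f : S →+* K) (c : ι → K), (∀ k, f (w k) = c k) → ∀ b g,
      (φ g).eval₂ f b = MvPolynomial.aeval (fun o : Option ι => o.elim b c) g := by
    intro f c hc b g
    have : (eval₂RingHom f b).comp φ = ((MvPolynomial.aeval (fun o : Option ι => o.elim b c) :
        MvPolynomial (Option ι) ℤ →ₐ[ℤ] K) : MvPolynomial (Option ι) ℤ →+* K) := by
      refine MvPolynomial.ringHom_ext (fun r => by simp) fun o => ?_
      rcases o with _ | k <;> simp [φ, hc]
    exact DFunLike.congr_fun this g
  have hcl := hv.mem_range_of_root hij hmax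
  by_cases hb : b ∈ i.range
  · obtain ⟨e, rfl⟩ := hb
    refine ⟨j e, fun g _ => ?_⟩
    rw [← hφ i a hwi, ← hφ j a' hwj, eval₂_at_apply, eval₂_at_apply]
    exact hij n hn _
  · obtain ⟨b', hb'⟩ := hv.exists_match hij
      (hcl ((s.image φ).sup natDegree + 1)) hb (s.image φ)
      (fun g hg => Nat.lt_succ_of_le (Finset.le_sup hg)) hn
    refine ⟨b', fun g hg => ?_⟩
    rw [← hφ i a hwi, ← hφ j a' hwj]
    exact hb' _ (Finset.mem_image_of_mem _ hg)

end PartialIsomorphism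

section Saturation

theorem exists_eventually_forall {β : Type*} [Nonempty β] (P : ℕ → ℕ → β → Prop)
    (h : ∀ m, ∀ᶠ i in (hyperfilter ℕ : Filter ℕ), ∃ y, ∀ k < m, P k i y) :
    ∃ y : ℕ → β, ∀ k, ∀ᶠ i in (hyperfilter ℕ : Filter ℕ), P k i (y i) := by
  classical
  have hex : ∀ i, ∃ y, ∀ k < Nat.findGreatest (fun m => ∃ y, ∀ k < m, P k i y) i, P k i y :=
    fun i => Nat.findGreatest_spec (P := fun m => ∃ y, ∀ k < m, P k i y) (Nat.zero_le i)
      ⟨Classical.arbitrary β, by simp⟩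
  choose y hy using hex
  refine ⟨y, fun k => ?_⟩
  have hlarge : ∀ᶠ i in (hyperfilter ℕ : Filter ℕ), k + 1 ≤ i :=
    (Nat.hyperfilter_le_atTop (eventually_ge_atTop (k + 1)))
  filter_upwards [hlarge, h (k + 1)] with i hi hi'
  exact hy i k (Nat.lt_of_succ_le (Nat.le_findGreatest hi hi'))

variable {k : Type*} [Field k]

theorem powEquiv_germ_iff {n : ℕ} {x y : ℕ → k} :
    PowEquiv n (x : Germ (hyperfilter ℕ : Filter ℕ) k) (y : Germ (hyperfilter ℕ : Filter ℕ) k) ↔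
      ∀ᶠ i in (hyperfilter ℕ : Filter ℕ), PowEquiv n (x i) (y i) := by
  classical
  constructor
  · rintro ⟨z, hz, hxy⟩
    induction z using Germ.inductionOn with | _ z => ?_
    have hz' : ∀ᶠ i in (hyperfilter ℕ : Filter ℕ), z i ≠ 0 := by
      rw [Ultrafilter.eventually_not]
      exact fun h => hz (Germ.coe_eq.2 h)
    have hxy' : ∀ᶠ i in (hyperfilter ℕ : Filter ℕ), x i = y i * z i ^ n := Germ.coe_eq.1 hxy
    filter_upwards [hz', hxy'] with i h1 h2
    exact ⟨z i, h1, h2⟩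
  · intro h
    have : ∀ i, ∃ z : k, PowEquiv n (x i) (y i) → z ≠ 0 ∧ x i = y i * z ^ n := fun i => by
      by_cases hi : PowEquiv n (x i) (y i)
      · obtain ⟨z, hz⟩ := hi
        exact ⟨z, fun _ => hz⟩
      · exact ⟨0, fun h => absurd h hi⟩
    choose z hz using this
    refine ⟨(z : Germ (hyperfilter ℕ : Filter ℕ) k), fun h0 => ?_, Germ.coe_eq.2 ?_⟩
    · obtain ⟨i, hi, hi'⟩ := (h.and (Germ.coe_eq.1 h0)).exists
      exact (hz i hi).1 hi'
    · filter_upwards [h] with i hi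
      exact (hz i hi).2

theorem aeval_germ {ι : Type*} (a : ι → ℕ → k) (g : MvPolynomial ι ℤ) :
    MvPolynomial.aeval (fun q => (a q : Germ (hyperfilter ℕ : Filter ℕ) k)) g =
      ((fun i => MvPolynomial.aeval (fun q => a q i) g : ℕ → k) :
        Germ (hyperfilter ℕ : Filter ℕ) k) := by
  induction g using MvPolynomial.induction_on with
  | C r => simp
  | add f g hf hg => rw [map_add, hf, hg]; simp only [map_add]; rfl
  | mul_X f q hf => rw [map_mul, hf]; simp only [map_mul, MvPolynomial.aeval_X]; rfl

theorem sameType_germ_iff {ι : Type*} {a a' : ι → ℕ → k} :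
    SameType (fun q => (a q : Germ (hyperfilter ℕ : Filter ℕ) k))
      (fun q => (a' q : Germ (hyperfilter ℕ : Filter ℕ) k)) ↔
      ∀ g : MvPolynomial ι ℤ, ∀ n : ℕ, 0 < n → ∀ᶠ i in (hyperfilter ℕ : Filter ℕ),
        PowEquiv n (MvPolynomial.aeval (fun q => a q i) g)
          (MvPolynomial.aeval (fun q => a' q i) g) := by
  simp only [SameType, aeval_germ, powEquiv_germ_iff]

theorem Option.elim_germ {ι k : Type*} (a : ι → ℕ → k) (b : ℕ → k) :
    (fun o : Option ι => o.elim (b : Germ (hyperfilter ℕ : Filter ℕ) k) fun q => (a q : Germ _ k)) =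
      fun o : Option ι => ((o.elim b a : ℕ → k) : Germ (hyperfilter ℕ : Filter ℕ) k) := by
  ext o
  cases o <;> rfl

instance MvPolynomial.countable_int {ι : Type*} [Countable ι] : Countable (MvPolynomial ι ℤ) :=
  AddMonoidAlgebra.coeff_injective.countable

theorem CoarselyHenselian.exists_sameType {Γ₀ : Type*} [LinearOrderedCommGroupWithZero Γ₀]
    {v : Valuation (Germ (hyperfilter ℕ : Filter ℕ) k) Γ₀} (hv : CoarselyHenselian v)
    {ι : Type*} [Countable ι] {a a' : ι → ℕ → k}
    (h : SameType (fun q => (a q : Germ (hyperfilter ℕ : Filter ℕ) k))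
      (fun q => (a' q : Germ (hyperfilter ℕ : Filter ℕ) k))) (b : ℕ → k) :
    ∃ b' : ℕ → k, SameType
      (fun o : Option ι => ((o.elim b a : ℕ → k) : Germ (hyperfilter ℕ : Filter ℕ) k))
      (fun o : Option ι => ((o.elim b' a' : ℕ → k) : Germ (hyperfilter ℕ : Filter ℕ) k)) := by
  classical
  obtain ⟨e, he⟩ := exists_surjective_nat (MvPolynomial (Option ι) ℤ × ℕ)
  obtain ⟨b', hb'⟩ := exists_eventually_forall (fun m i (y : k) => PowEquiv ((e m).2 + 1)
    (MvPolynomial.aeval (fun o : Option ι => o.elim (b i) fun q => a q i) (e m).1)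
    (MvPolynomial.aeval (fun o : Option ι => o.elim y fun q => a' q i) (e m).1)) (by
      intro m
      obtain ⟨c, hc⟩ := hv.exists_match_of_sameType h b
        ((Finset.range m).image fun q => (e q).1) (n := ∏ q ∈ Finset.range m, ((e q).2 + 1))
        (Finset.prod_pos fun q _ => Nat.succ_pos _)
      induction c using Germ.inductionOn with | _ c => ?_
      have hq : ∀ q ∈ Finset.range m, ∀ᶠ i in (hyperfilter ℕ : Filter ℕ), PowEquiv ((e q).2 + 1)
          (MvPolynomial.aeval (fun o : Option ι => o.elim (b i) fun q => a q i) (e q).1)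
          (MvPolynomial.aeval (fun o : Option ι => o.elim (c i) fun q => a' q i) (e q).1) := by
        intro q hq
        have := (hc _ (Finset.mem_image_of_mem _ hq)).of_dvd
          (Finset.dvd_prod_of_mem (fun q => (e q).2 + 1) hq)
        rw [Option.elim_germ, Option.elim_germ, aeval_germ, aeval_germ, powEquiv_germ_iff] at this
        simpa only [Option.elim_apply] using this
      filter_upwards [(Finset.eventually_all _).2 hq] with i hi
      exact ⟨c i, fun q hq => hi q (Finset.mem_range.2 hq)⟩)
  refine ⟨b', sameType_germ_iff.2 fun g n hn => ?_⟩
  obtain ⟨m, hm⟩ := he (g, n - 1)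
  have := hb' m
  rw [hm] at this
  simp only [Nat.sub_add_cancel hn] at this
  simpa only [Option.elim_apply] using this

end Saturation

section Padic

open Polynomial

variable {p : ℕ} [hp : Fact p.Prime]

theorem PadicInt.exists_root_one_add_self (Q : ℤ_[p][X]) :
    ∃ w : ℤ_[p], 1 + w + p * w ^ 2 * Q.eval w = 0 := by
  set F : ℤ_[p][X] := 1 + X + C (p : ℤ_[p]) * X ^ 2 * Q with hF
  have hlt : ∀ t : ℤ_[p], ‖(p : ℤ_[p]) * t‖ < 1 := fun t => by
    rw [norm_mul]
    exact mul_lt_one_of_nonneg_of_lt_one_left (norm_nonneg _) (by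
      rw [PadicInt.norm_p]
      exact inv_lt_one_of_one_lt₀ (by exact_mod_cast hp.out.one_lt)) t.norm_le_one
  have h1 : ‖F.derivative.eval (-1)‖ = 1 := by
    have : F.derivative.eval (-1) =
        1 + p * (-2 * Q.eval (-1) + Q.derivative.eval (-1)) := by
      simp [hF]; ring
    rw [this, PadicInt.norm_add_eq_max_of_ne] <;> rw [norm_one]
    · exact max_eq_left (hlt _).le
    · exact (hlt _).ne'
  have h0 : ‖F.eval (-1)‖ < 1 := by
    have : F.eval (-1) = p * Q.eval (-1) := by simp [hF]
    rw [this]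
    exact hlt _
  obtain ⟨w, hw, -⟩ := hensels_lemma (F := F) (a := (-1 : ℤ_[p])) (by
    change ‖F.eval (-1)‖ < ‖F.derivative.eval (-1)‖ ^ 2
    rwa [h1, one_pow])
  exact ⟨w, by simpa [hF] using hw⟩

theorem PadicInt.exists_pow_eq_of_norm_lt {n : ℕ} {y : ℤ_[p]} (hy : ‖1 - y‖ < ‖(n : ℤ_[p])‖ ^ 2) :
    ∃ z : ℤ_[p], z ^ n = y := by
  obtain ⟨z, hz, -⟩ := hensels_lemma (F := X ^ n - C y) (a := (1 : ℤ_[p])) (by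
    simpa [derivative_X_pow] using hy)
  exact ⟨z, by simpa [sub_eq_zero] using hz⟩

/-- Finitely many natural numbers represent all classes of nonzero elements modulo powers. -/
theorem Padic.exists_natCast_mul_eq_pow {n : ℕ} (hn : 0 < n) :
    ∃ T : Finset ℕ, ∀ x : ℚ_[p], x ≠ 0 → ∃ q ∈ T, q ≠ 0 ∧ ∃ y, y ^ n = q * x := by
  have hn0 : 0 < ‖(n : ℤ_[p])‖ ^ 2 := by
    have : (n : ℤ_[p]) ≠ 0 := by exact_mod_cast hn.ne'
    positivity
  have hp1 : (1 : ℝ) < p := by exact_mod_cast hp.out.one_lt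
  obtain ⟨M, hM⟩ := exists_pow_lt_of_lt_one hn0 (inv_lt_one_of_one_lt₀ hp1)
  refine ⟨(Finset.range n ×ˢ Finset.range (p ^ M)).image fun q => p ^ q.1 * q.2, fun x hx => ?_⟩
  have hp0 : (p : ℚ_[p]) ≠ 0 := by exact_mod_cast hp.out.ne_zero
  set r := (-x.valuation % n).toNat with hr
  have hn' : (0 : ℤ) < n := by exact_mod_cast hn
  have hr0 : (r : ℤ) = -x.valuation % n := Int.toNat_of_nonneg (Int.emod_nonneg _ hn'.ne')
  have hrn : r < n := by
    have := Int.emod_lt_of_pos (-x.valuation) hn'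
    omega
  set e := -x.valuation / n
  have he : x.valuation + r = n * (-e) := by
    rw [hr0]
    have := Int.emod_add_mul_ediv (-x.valuation) n
    linarith
  set u : ℚ_[p] := x * (p : ℚ_[p]) ^ (-x.valuation) with hu
  have hu1 : ‖u‖ = 1 := by
    rw [hu, norm_mul, Padic.norm_p_zpow, Padic.norm_eq_zpow_neg_valuation hx, neg_neg,
      ← zpow_add₀ (by positivity), neg_add_cancel, zpow_zero]
  set U := PadicInt.mkUnits hu1 with hU
  have hUu : ((U : ℤ_[p]) : ℚ_[p]) = u := PadicInt.mkUnits_eq hu1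
  set q := (U⁻¹ : ℤ_[p]ˣ).val.appr M with hq
  have hqU : ‖1 - (q : ℤ_[p]) * U‖ < ‖(n : ℤ_[p])‖ ^ 2 := by
    refine lt_of_le_of_lt ?_ hM
    have h1 : 1 - (q : ℤ_[p]) * U = ((U⁻¹ : ℤ_[p]ˣ) - q) * U := by
      rw [sub_mul, Units.inv_mul]
    have h2 := (PadicInt.norm_le_pow_iff_mem_span_pow _ M).2
      (PadicInt.appr_spec M (U⁻¹ : ℤ_[p]ˣ).val)
    rw [h1, norm_mul, PadicInt.norm_units, mul_one]
    rwa [zpow_neg, zpow_natCast, ← inv_pow] at h2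
  obtain ⟨z, hz⟩ := PadicInt.exists_pow_eq_of_norm_lt hqU
  have hq0 : q ≠ 0 := by
    intro h
    rw [h, Nat.cast_zero, zero_mul, sub_zero, norm_one] at hqU
    exact not_le.2 hqU (pow_le_one₀ (norm_nonneg _) (PadicInt.norm_le_one _))
  refine ⟨p ^ r * q, Finset.mem_image.2 ⟨(r, q), ?_, rfl⟩,
    mul_ne_zero (pow_ne_zero _ hp.out.ne_zero) hq0, (p : ℚ_[p]) ^ (-e) * z, ?_⟩
  · simpa using ⟨hrn, PadicInt.appr_lt _ _⟩
  · have hz' : (z : ℚ_[p]) ^ n = q * u := by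
      rw [← hUu]; exact_mod_cast congrArg (fun t : ℤ_[p] => (t : ℚ_[p])) hz
    rw [mul_pow, hz', hu, ← zpow_natCast, ← zpow_mul, mul_comm (-e) (n : ℤ), ← he,
      zpow_add₀ hp0, zpow_neg, zpow_natCast]
    have : (p : ℚ_[p]) ^ x.valuation ≠ 0 := zpow_ne_zero _ hp0
    push_cast
    field_simp

theorem Padic.norm_sub_le_of_powEquiv {x x' : ℚ_[p]} {r : ℚ} {k : ℤ}
    (hr : ‖x - r‖ < (p : ℝ) ^ (-(k + 1)))
    (h0 : PowEquiv 2 (x - ((r + p ^ k : ℚ) : ℚ_[p])) (x' - ((r + p ^ k : ℚ) : ℚ_[p])))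
    (h1 : PowEquiv 2 (x - ((r + p ^ (k + 1) : ℚ) : ℚ_[p])) (x' - ((r + p ^ (k + 1) : ℚ) : ℚ_[p]))) :
    ‖x - x'‖ ≤ (p : ℝ) ^ (-k) := by
  have hp1 : (1 : ℝ) < p := by exact_mod_cast hp.out.one_lt
  by_contra! hlt
  have key : ∀ m : ℤ, k ≤ m → m ≤ k + 1 →
      PowEquiv 2 (x - ((r + p ^ m : ℚ) : ℚ_[p])) (x' - ((r + p ^ m : ℚ) : ℚ_[p])) →
      ∃ z : ℚ_[p], z ≠ 0 ∧ (p : ℝ) ^ (-m) = ‖x - x'‖ * ‖z‖ ^ 2 := by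
    rintro m hkm hmk ⟨z, hz, h⟩
    have hm1 : (p : ℝ) ^ (-(k + 1)) ≤ (p : ℝ) ^ (-m) := zpow_le_zpow_right₀ hp1.le (by omega)
    have hm2 : (p : ℝ) ^ (-m) ≤ (p : ℝ) ^ (-k) := zpow_le_zpow_right₀ hp1.le (by omega)
    have hnp : ‖-(p : ℚ_[p]) ^ m‖ = (p : ℝ) ^ (-m) := by rw [norm_neg, Padic.norm_p_zpow]
    have hxt : ‖x - ((r + p ^ m : ℚ) : ℚ_[p])‖ = (p : ℝ) ^ (-m) := by
      rw [show x - ((r + p ^ m : ℚ) : ℚ_[p]) = (x - r) + -(p : ℚ_[p]) ^ m by push_cast; ring,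
        Padic.add_eq_max_of_ne (by rw [hnp]; exact (hr.trans_le hm1).ne), hnp,
        max_eq_right (hr.le.trans hm1)]
    have hxt' : ‖x' - ((r + p ^ m : ℚ) : ℚ_[p])‖ = ‖x - x'‖ := by
      rw [show x' - ((r + p ^ m : ℚ) : ℚ_[p]) =
          -(x - x') + (x - ((r + p ^ m : ℚ) : ℚ_[p])) by ring,
        Padic.add_eq_max_of_ne (by rw [hxt, norm_neg]; exact (hm2.trans_lt hlt).ne'), hxt, norm_neg,
        max_eq_left (hm2.trans hlt.le)]
    exact ⟨z, hz, by rw [← hxt, h, norm_mul, norm_pow, hxt']⟩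
  obtain ⟨z, hz, hk⟩ := key k le_rfl (by omega) h0
  obtain ⟨w, hw, hk'⟩ := key (k + 1) (by omega) le_rfl h1
  have hD : ‖x - x'‖ ≠ 0 := (lt_trans (by positivity) hlt).ne'
  rw [Padic.norm_eq_zpow_neg_valuation hz, ← zpow_natCast, ← zpow_mul] at hk
  rw [Padic.norm_eq_zpow_neg_valuation hw, ← zpow_natCast, ← zpow_mul] at hk'
  have h2 : (p : ℝ) ^ (-k + -w.valuation * (2 : ℕ)) =
      (p : ℝ) ^ (-(k + 1) + -z.valuation * (2 : ℕ)) := by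
    rw [zpow_add₀ (by positivity), zpow_add₀ (by positivity), hk, hk']
    ring
  have := zpow_right_injective₀ (by positivity) hp1.ne' h2
  push_cast at this
  omega

end Padic

section CoarseValuation

open Polynomial

variable (p : ℕ) [hp : Fact p.Prime]

/-- The ultrapower of the `p`-adic numbers. -/
abbrev PadicGerm : Type := Germ (hyperfilter ℕ : Filter ℕ) ℚ_[p]

/-- The ring of bounded elements of the ultrapower. -/
def boundedGerms : ValuationSubring (PadicGerm p) where
  carrier := {x | ∃ C : ℝ, x.LiftPred fun y => ‖y‖ ≤ C}
  mul_mem' := by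
    rintro x y ⟨C, hC⟩ ⟨D, hD⟩
    induction x using Germ.inductionOn with | _ x => ?_
    induction y using Germ.inductionOn with | _ y => ?_
    refine ⟨C * D, ?_⟩
    rw [Germ.liftPred_coe] at hC hD
    change Germ.LiftPred _ ((x * y : ℕ → ℚ_[p]) : PadicGerm p)
    rw [Germ.liftPred_coe]
    filter_upwards [hC, hD] with i h1 h2
    rw [Pi.mul_apply, norm_mul]
    exact mul_le_mul h1 h2 (norm_nonneg _) ((norm_nonneg _).trans h1)
  one_mem' := ⟨1, Germ.liftPred_coe.2 (by simp)⟩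
  add_mem' := by
    rintro x y ⟨C, hC⟩ ⟨D, hD⟩
    induction x using Germ.inductionOn with | _ x => ?_
    induction y using Germ.inductionOn with | _ y => ?_
    refine ⟨C + D, ?_⟩
    rw [Germ.liftPred_coe] at hC hD
    change Germ.LiftPred _ ((x + y : ℕ → ℚ_[p]) : PadicGerm p)
    rw [Germ.liftPred_coe]
    filter_upwards [hC, hD] with i h1 h2
    exact (norm_add_le _ _).trans (add_le_add h1 h2)
  zero_mem' := ⟨0, Germ.liftPred_coe.2 (by simp)⟩
  neg_mem' := by
    rintro x ⟨C, hC⟩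
    induction x using Germ.inductionOn with | _ x => ?_
    refine ⟨C, ?_⟩
    rw [Germ.liftPred_coe] at hC
    change Germ.LiftPred _ ((-x : ℕ → ℚ_[p]) : PadicGerm p)
    rw [Germ.liftPred_coe]
    simpa using hC
  mem_or_inv_mem' := by
    intro x
    induction x using Germ.inductionOn with | _ x => ?_
    by_cases h : ∀ᶠ i in (hyperfilter ℕ : Filter ℕ), ‖x i‖ ≤ 1
    · exact Or.inl ⟨1, Germ.liftPred_coe.2 h⟩
    · refine Or.inr ⟨1, ?_⟩
      change Germ.LiftPred _ ((x⁻¹ : ℕ → ℚ_[p]) : PadicGerm p)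
      rw [Germ.liftPred_coe]
      rw [← Ultrafilter.eventually_not] at h
      filter_upwards [h] with i hi
      rw [Pi.inv_apply, norm_inv]
      exact inv_le_one_of_one_le₀ (not_le.1 hi).le

variable {p}

theorem boundedGerms_valuation_le_one_iff {x : ℕ → ℚ_[p]} :
    (boundedGerms p).valuation (x : PadicGerm p) ≤ 1 ↔
      ∃ C : ℝ, ∀ᶠ i in (hyperfilter ℕ : Filter ℕ), ‖x i‖ ≤ C :=
  (boundedGerms p).valuation_le_one_iff _

theorem boundedGerms_valuation_lt_one_iff {x : ℕ → ℚ_[p]} :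
    (boundedGerms p).valuation (x : PadicGerm p) < 1 ↔
      Tendsto x (hyperfilter ℕ : Filter ℕ) (𝓝 0) := by
  rw [← not_le, NormedAddGroup.tendsto_nhds_zero, not_iff_comm]
  push Not
  have hinv : (x : PadicGerm p) ≠ 0 → (1 ≤ (boundedGerms p).valuation (x : PadicGerm p) ↔
      ∃ C : ℝ, ∀ᶠ i in (hyperfilter ℕ : Filter ℕ), ‖x i‖⁻¹ ≤ C) := by
    intro hx
    have h : (boundedGerms p).valuation ((x⁻¹ : ℕ → ℚ_[p]) : PadicGerm p) =
        ((boundedGerms p).valuation (x : PadicGerm p))⁻¹ := map_inv₀ (boundedGerms p).valuation (x : PadicGerm p)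
    rw [← inv_le_one₀ (zero_lt_iff.2 (by simpa using hx)), ← h, boundedGerms_valuation_le_one_iff]
    simp only [Pi.inv_apply, norm_inv]
  constructor
  · rintro ⟨ε, hε, h⟩
    rw [hinv]
    · refine ⟨ε⁻¹, ?_⟩
      filter_upwards [h] with i hi
      exact inv_anti₀ hε hi
    · intro h0
      obtain ⟨i, hi, hi'⟩ := (h.and (Germ.coe_eq.1 h0)).exists
      rw [hi'] at hi
      exact hε.not_ge (hi.trans_eq norm_zero)
  · intro h
    have hx : (x : PadicGerm p) ≠ 0 := by
      intro h0
      rw [h0, map_zero] at h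
      exact not_le.2 one_pos h
    obtain ⟨C, hC⟩ := (hinv hx).1 h
    refine ⟨(|C| + 1)⁻¹, by positivity, ?_⟩
    have hne : ∀ᶠ i in (hyperfilter ℕ : Filter ℕ), x i ≠ 0 := by
      rw [Ultrafilter.eventually_not]
      exact fun h => hx (Germ.coe_eq.2 h)
    filter_upwards [hC, hne] with i hi hi0
    rw [inv_le_comm₀ (by positivity) (norm_pos_iff.2 hi0)]
    linarith [le_abs_self C]

theorem boundedGerms_sub_lt_one (x x' : PadicGerm p) (hx : (boundedGerms p).valuation x ≤ 1)
    (h : ∀ t : ℚ, PowEquiv 2 (x - t) (x' - t)) : (boundedGerms p).valuation (x - x') < 1 := by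
  have hp1 : (1 : ℝ) < p := by exact_mod_cast hp.out.one_lt
  induction x using Germ.inductionOn with | _ x => ?_
  induction x' using Germ.inductionOn with | _ x' => ?_
  obtain ⟨C, hC⟩ := boundedGerms_valuation_le_one_iff.1 hx
  obtain ⟨s, -, hs⟩ := (isCompact_closedBall (0 : ℚ_[p]) C).ultrafilter_le_nhds
    ((hyperfilter ℕ).map x) (le_principal_iff.2 (hC.mono fun i hi => by simpa using hi))
  have hs' : Tendsto x (hyperfilter ℕ : Filter ℕ) (𝓝 s) := hs
  change (boundedGerms p).valuation ((x - x' : ℕ → ℚ_[p]) : PadicGerm p) < 1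
  rw [boundedGerms_valuation_lt_one_iff, NormedAddGroup.tendsto_nhds_zero]
  intro ε hε
  obtain ⟨k, hk⟩ := exists_pow_lt_of_lt_one hε (inv_lt_one_of_one_lt₀ hp1)
  have hpos : 0 < (p : ℝ) ^ (-((k : ℤ) + 1)) := by positivity
  obtain ⟨r, hr⟩ := Padic.rat_dense p s hpos
  have hxr : ∀ᶠ i in (hyperfilter ℕ : Filter ℕ), ‖x i - r‖ < (p : ℝ) ^ (-((k : ℤ) + 1)) :=
    ((hs'.sub_const (r : ℚ_[p])).norm).eventually_lt_const hr
  have hpow : ∀ t : ℚ, ∀ᶠ i in (hyperfilter ℕ : Filter ℕ), PowEquiv 2 (x i - t) (x' i - t) := by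
    intro t
    have ht : (t : PadicGerm p) = ((fun _ => (t : ℚ_[p]) : ℕ → ℚ_[p]) : PadicGerm p) :=
      (map_ratCast ((Germ.coeRingHom (hyperfilter ℕ : Filter ℕ)).comp
        (Pi.constRingHom ℕ ℚ_[p])) t).symm
    have := h t
    rw [ht] at this
    exact powEquiv_germ_iff.1 this
  filter_upwards [hxr, hpow (r + p ^ (k : ℤ)), hpow (r + p ^ ((k : ℤ) + 1))] with i h1 h2 h3
  refine lt_of_le_of_lt (Padic.norm_sub_le_of_powEquiv h1 h2 h3) ?_
  rwa [zpow_neg, zpow_natCast, ← inv_pow]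

theorem boundedGerms_exists_root (G : (PadicGerm p)[X]) (h0 : G.coeff 0 = 1) (h1 : G.coeff 1 = 1)
    (h : ∀ l, 2 ≤ l → (boundedGerms p).valuation (G.coeff l) < 1) :
    ∃ w, (boundedGerms p).valuation w ≤ 1 ∧ G.eval w = 0 := by
  have hp0 : (p : ℚ_[p]) ≠ 0 := by exact_mod_cast hp.out.ne_zero
  have hrep : ∀ l, ∃ c : ℕ → ℚ_[p], (c : PadicGerm p) = G.coeff (l + 2) := fun l =>
    (G.coeff (l + 2)).inductionOn fun c => ⟨c, rfl⟩
  choose c hc using hrep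
  obtain ⟨N, hN⟩ : ∃ N, G.natDegree = N + 1 :=
    Nat.exists_eq_succ_of_ne_zero fun hd => by
      have := coeff_eq_zero_of_natDegree_lt (p := G) (n := 1) (by omega)
      rw [h1] at this
      exact one_ne_zero this
  have hsmall : ∀ l, ∀ᶠ i in (hyperfilter ℕ : Filter ℕ), ‖c l i / p‖ ≤ 1 := by
    intro l
    have h2 := h (l + 2) (by omega)
    rw [← hc, boundedGerms_valuation_lt_one_iff] at h2
    have h3 := (h2.norm).eventually_lt_const (u := (p : ℝ)⁻¹) (by
      rw [norm_zero]
      exact inv_pos.2 (by exact_mod_cast hp.out.pos))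
    filter_upwards [h3] with i hi
    rw [norm_div, Padic.norm_p, div_inv_eq_mul]
    have : (0 : ℝ) < p := by exact_mod_cast hp.out.pos
    rw [inv_eq_one_div, lt_div_iff₀ this] at hi
    exact hi.le
  have hroot : ∀ i, ∃ w : ℤ_[p], (∀ l ∈ Finset.range N, ‖c l i / p‖ ≤ 1) →
      ∑ l ∈ Finset.range N, c l i * (w : ℚ_[p]) ^ (l + 2) + w + 1 = 0 := by
    intro i
    by_cases hi : ∀ l ∈ Finset.range N, ‖c l i / p‖ ≤ 1
    · have : ∀ l, ∃ d : ℤ_[p], l ∈ Finset.range N → c l i = p * d := fun l => by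
        by_cases hl : l ∈ Finset.range N
        · exact ⟨⟨c l i / p, hi l hl⟩, fun _ => by field_simp⟩
        · exact ⟨0, fun h => absurd h hl⟩
      choose d hd using this
      obtain ⟨w, hw⟩ := PadicInt.exists_root_one_add_self
        (∑ l ∈ Finset.range N, C (d l) * X ^ l)
      refine ⟨w, fun _ => ?_⟩
      have hw' := congrArg (PadicInt.Coe.ringHom (p := p)) hw
      simp only [eval_finsetSum, eval_mul, eval_C, eval_pow, eval_X, map_add, map_mul, map_sum, map_pow,
        map_one, map_zero, map_natCast] at hw'
      change 1 + (w : ℚ_[p]) + p * (w : ℚ_[p]) ^ 2 * ∑ l ∈ Finset.range N,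
        (d l : ℚ_[p]) * (w : ℚ_[p]) ^ l = 0 at hw'
      rw [← hw', Finset.mul_sum, add_comm (1 : ℚ_[p]), add_assoc, add_comm]
      congr 1
      refine Finset.sum_congr rfl fun l hl => ?_
      rw [hd l hl]
      ring
    · exact ⟨0, fun h => absurd h hi⟩
  choose w hw using hroot
  refine ⟨((fun i => (w i : ℚ_[p]) : ℕ → ℚ_[p]) : PadicGerm p),
    boundedGerms_valuation_le_one_iff.2 ⟨1, Eventually.of_forall fun i => (w i).norm_le_one⟩, ?_⟩
  rw [eval_eq_sum_range, hN, Finset.sum_range_succ', Finset.sum_range_succ', h0, h1]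
  simp only [add_assoc, ← hc]
  have : ∀ s : Finset ℕ, ∑ l ∈ s, (c l : PadicGerm p) *
      ((fun i => (w i : ℚ_[p]) : ℕ → ℚ_[p]) : PadicGerm p) ^ (l + (1 + 1)) =
      ((fun i => ∑ l ∈ s, c l i * (w i : ℚ_[p]) ^ (l + 2) : ℕ → ℚ_[p]) : PadicGerm p) := by
    classical
    intro s
    induction s using Finset.induction_on with
    | empty => rfl
    | insert a s ha ih =>
      simp only [Finset.sum_insert ha]
      rw [ih]
      rfl
  rw [this]
  simp only [zero_add, pow_one, one_mul, pow_zero]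
  refine Germ.coe_eq.2 ?_
  filter_upwards [(Finset.eventually_all _).2 fun l _ => hsmall l] with i hi
  exact (add_assoc _ _ _).symm.trans (hw i hi)

theorem coarselyHenselian_boundedGerms : CoarselyHenselian (boundedGerms p).valuation where
  exists_lt_one := by
    have hp1 : (1 : ℝ) < p := by exact_mod_cast hp.out.one_lt
    refine ⟨((fun i => (p : ℚ_[p]) ^ i : ℕ → ℚ_[p]) : PadicGerm p), fun h => ?_,
      boundedGerms_valuation_lt_one_iff.2 ?_⟩
    · obtain ⟨i, hi⟩ := (Germ.coe_eq.1 h).exists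
      exact pow_ne_zero i (by exact_mod_cast hp.out.ne_zero) hi
    · refine Tendsto.mono_left ?_ Nat.hyperfilter_le_atTop
      exact tendsto_pow_atTop_nhds_zero_of_norm_lt_one Padic.norm_p_lt_one
  map_natCast n hn := by
    refine le_antisymm (Valuation.map_natCast_le_one _ n) (not_lt.1 fun hlt => ?_)
    have hlt' : Tendsto (fun _ : ℕ => (n : ℚ_[p])) (hyperfilter ℕ : Filter ℕ) (𝓝 0) :=
      boundedGerms_valuation_lt_one_iff.1 hlt
    exact hn (by exact_mod_cast tendsto_const_nhds_iff.1 hlt')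
  exists_root := boundedGerms_exists_root
  exists_pow_eq n hn x hx := by
    induction x using Germ.inductionOn with | _ x => ?_
    obtain ⟨T, hT⟩ := Padic.exists_natCast_mul_eq_pow (p := p) hn
    have hne : ∀ᶠ i in (hyperfilter ℕ : Filter ℕ), x i ≠ 0 := by
      rw [Ultrafilter.eventually_not]
      exact fun h => hx (Germ.coe_eq.2 h)
    have hex : ∀ᶠ i in (hyperfilter ℕ : Filter ℕ), ∃ q ∈ (T : Set ℕ),
        q ≠ 0 ∧ ∃ y, y ^ n = q * x i := hne.mono fun i hi => hT _ hi
    obtain ⟨q, -, hq⟩ := (Ultrafilter.eventually_exists_mem_iff T.finite_toSet).1 hex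
    refine ⟨q, hq.exists.choose_spec.1, ?_⟩
    have : ∀ i, ∃ y, (∃ y, y ^ n = q * x i) → y ^ n = q * x i := fun i => by
      by_cases h : ∃ y, y ^ n = q * x i
      · exact ⟨h.choose, fun _ => h.choose_spec⟩
      · exact ⟨0, fun h' => absurd h' h⟩
    choose y hy using this
    refine ⟨(y : PadicGerm p), Germ.coe_eq.2 ?_⟩
    filter_upwards [hq] with i hi
    exact hy i hi.2
  sub_lt_one := boundedGerms_sub_lt_one

end CoarseValuation

section Formulas

open FirstOrder.Ring FirstOrder.Language

variable {k : Type*} [Field k] [CompatibleRing k]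

theorem FirstOrder.Language.Term.exists_realize_eq_aeval {β : Type*} (t : Language.ring.Term β) :
    ∃ g : MvPolynomial β ℤ, ∀ a : β → k, t.realize a = MvPolynomial.aeval a g := by
  induction t with
  | var q => exact ⟨MvPolynomial.X q, fun a => by simp⟩
  | func f ts ih =>
    choose g hg using ih
    cases f with
    | add =>
      refine ⟨g 0 + g 1, fun a => ?_⟩
      rw [map_add, ← hg, ← hg]
      exact CompatibleRing.funMap_add _
    | mul =>
      refine ⟨g 0 * g 1, fun a => ?_⟩
      rw [map_mul, ← hg, ← hg]
      exact CompatibleRing.funMap_mul _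
    | neg =>
      refine ⟨-g 0, fun a => ?_⟩
      rw [map_neg, ← hg]
      exact CompatibleRing.funMap_neg _
    | zero => exact ⟨0, fun a => by rw [map_zero]; exact CompatibleRing.funMap_zero _⟩
    | one => exact ⟨1, fun a => by rw [map_one]; exact CompatibleRing.funMap_one _⟩

theorem SameType.symm {K ι : Type*} [Field K] {a a' : ι → K} (h : SameType a a') :
    SameType a' a := fun g n hn => (h g n hn).symm

theorem SameType.comp {K ι κ : Type*} [Field K] {a a' : ι → K} (h : SameType a a') (e : κ → ι) :
    SameType (a ∘ e) (a' ∘ e) := fun g n hn => by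
  simpa only [MvPolynomial.aeval_rename] using h (MvPolynomial.rename e g) n hn

theorem CoarselyHenselian.eventually_realize_iff {Γ₀ : Type*} [LinearOrderedCommGroupWithZero Γ₀]
    {v : Valuation (Germ (hyperfilter ℕ : Filter ℕ) k) Γ₀} (hv : CoarselyHenselian v)
    {α : Type*} [Countable α] {n : ℕ} (φ : Language.ring.BoundedFormula α n)
    {V V' : α → ℕ → k} {X X' : Fin n → ℕ → k}
    (h : SameType (fun q => ((Sum.elim V X q : ℕ → k) : Germ (hyperfilter ℕ : Filter ℕ) k))
      (fun q => ((Sum.elim V' X' q : ℕ → k) : Germ (hyperfilter ℕ : Filter ℕ) k))) :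
    (∀ᶠ i in (hyperfilter ℕ : Filter ℕ), φ.Realize (fun q => V q i) (fun j => X j i)) ↔
      ∀ᶠ i in (hyperfilter ℕ : Filter ℕ), φ.Realize (fun q => V' q i) (fun j => X' j i) := by
  induction φ generalizing V V' with
  | falsum => simp [BoundedFormula.Realize]
  | rel R => exact R.elim
  | @equal m s t =>
    obtain ⟨g, hg⟩ := s.exists_realize_eq_aeval (k := k)
    obtain ⟨g', hg'⟩ := t.exists_realize_eq_aeval (k := k)
    have key := sameType_germ_iff.1 h (g - g') 1 one_pos
    have e : ∀ (V : α → ℕ → k) (X : Fin m → ℕ → k) i,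
        Sum.elim (fun q => V q i) (fun j => X j i) = fun q => Sum.elim V X q i := by
      intro V X i
      ext (q | q) <;> rfl
    simp only [BoundedFormula.Realize, hg, hg', e]
    refine eventually_congr (key.mono fun i hi => ?_)
    simpa only [map_sub, sub_eq_zero] using hi.eq_zero_iff
  | imp φ ψ ihφ ihψ =>
    simp only [BoundedFormula.realize_imp, Ultrafilter.eventually_imp]
    rw [ihφ h, ihψ h]
  | @all n φ ih =>
    simp only [BoundedFormula.realize_all]
    have extend : ∀ {V V' : α → ℕ → k} {X X' : Fin n → ℕ → k},
        SameType (fun q => ((Sum.elim V X q : ℕ → k) : Germ (hyperfilter ℕ : Filter ℕ) k))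
          (fun q => ((Sum.elim V' X' q : ℕ → k) : Germ (hyperfilter ℕ : Filter ℕ) k)) →
        (∀ᶠ i in (hyperfilter ℕ : Filter ℕ), ∀ b,
          φ.Realize (fun q => V q i) (Fin.snoc (fun j => X j i) b)) →
        ∀ᶠ i in (hyperfilter ℕ : Filter ℕ), ∀ b,
          φ.Realize (fun q => V' q i) (Fin.snoc (fun j => X' j i) b) := by
      intro V V' X X' h hall
      by_contra hnot
      rw [← Ultrafilter.eventually_not] at hnot
      push Not at hnot
      have : ∀ i, ∃ b, (∃ b, ¬ φ.Realize (fun q => V' q i) (Fin.snoc (fun j => X' j i) b)) →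
          ¬ φ.Realize (fun q => V' q i) (Fin.snoc (fun j => X' j i) b) := fun i => by
        by_cases hb : ∃ b, ¬ φ.Realize (fun q => V' q i) (Fin.snoc (fun j => X' j i) b)
        · exact ⟨hb.choose, fun _ => hb.choose_spec⟩
        · exact ⟨0, fun hb' => absurd hb' hb⟩
      choose b' hb' using this
      obtain ⟨b, hb⟩ := hv.exists_sameType h.symm b'
      have e : ∀ (V : α → ℕ → k) (X : Fin n → ℕ → k) (b : ℕ → k),
          (fun q => ((Sum.elim V (Fin.snoc X b : Fin (n + 1) → ℕ → k) q : ℕ → k) :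
            Germ (hyperfilter ℕ : Filter ℕ) k)) =
          (fun o : Option (α ⊕ Fin n) => ((o.elim b (Sum.elim V X) : ℕ → k) :
            Germ (hyperfilter ℕ : Filter ℕ) k)) ∘
          Sum.elim (fun q => some (Sum.inl q))
            (Fin.snoc (fun j => some (Sum.inr j)) none : Fin (n + 1) → Option (α ⊕ Fin n)) := by
        intro V X b
        ext (q | j)
        · rfl
        · induction j using Fin.lastCases <;> simp
      have snoc : ∀ (X : Fin n → ℕ → k) (b : ℕ → k) i,
          (fun j => (Fin.snoc X b : Fin (n + 1) → ℕ → k) j i) =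
            Fin.snoc (fun j => X j i) (b i) := by
        intro X b i
        ext j
        induction j using Fin.lastCases <;> simp
      have hIH := ih (V := V) (V' := V') (X := Fin.snoc X b) (X' := Fin.snoc X' b') (by
        rw [e, e]
        exact hb.symm.comp _)
      simp only [snoc] at hIH
      obtain ⟨i, hi, hi'⟩ := ((hIH.1 (hall.mono fun i hi => hi (b i))).and hnot).exists
      exact hb' i hi' hi
    exact ⟨extend h, extend h.symm⟩

end Formulas

section Constants

open Polynomial

variable {p : ℕ} [hp : Fact p.Prime]

variable (p) in
/-- The diagonal embedding of `ℚ_p` into its ultrapower. -/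
noncomputable def constGerm : ℚ_[p] →+* PadicGerm p :=
  (Germ.coeRingHom (hyperfilter ℕ : Filter ℕ)).comp (Pi.constRingHom ℕ ℚ_[p])

theorem boundedGerms_valuation_constGerm {c : ℚ_[p]} (hc : c ≠ 0) :
    (boundedGerms p).valuation (constGerm p c) = 1 := by
  refine le_antisymm (boundedGerms_valuation_le_one_iff.2 ⟨‖c‖, Eventually.of_forall fun _ => le_rfl⟩)
    (not_lt.1 fun hlt => hc ?_)
  have hlt' : Tendsto (fun _ : ℕ => c) (hyperfilter ℕ : Filter ℕ) (𝓝 0) :=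
    boundedGerms_valuation_lt_one_iff.1 hlt
  exact tendsto_const_nhds_iff.1 hlt'

theorem powEquiv_eval₂_constGerm {n : ℕ} (hn : 0 < n) {x : PadicGerm p} (hx0 : x ≠ 0)
    (hx : (boundedGerms p).valuation x < 1) (P : ℚ_[p][X]) :
    PowEquiv n (P.eval₂ (constGerm p) x)
      (constGerm p (P.coeff P.natTrailingDegree) * x ^ P.natTrailingDegree) := by
  rcases eq_or_ne P 0 with rfl | hP
  · simpa using PowEquiv.refl n (0 : PadicGerm p)
  rw [eval₂_eq_eval_map, ← coeff_map]
  have hx0' : 0 < (boundedGerms p).valuation x := zero_lt_iff.2 (by simpa using hx0)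
  refine coarselyHenselian_boundedGerms.powEquiv_eval_of_dominant (fun l hl => ?_) hn
  have hν : P.coeff P.natTrailingDegree ≠ 0 := by simpa using hP
  rw [coeff_map, coeff_map, boundedGerms_valuation_constGerm hν, one_mul]
  rcases eq_or_ne (P.coeff l) 0 with h0 | h0
  · rw [h0, map_zero, map_zero, zero_mul]
    exact pow_pos hx0' _
  · rw [boundedGerms_valuation_constGerm h0, one_mul]
    exact pow_lt_pow_right_of_lt_one₀ hx0' hx
      (lt_of_le_of_ne (natTrailingDegree_le_of_ne_zero h0) hl.symm)

theorem sameType_eval₂_constGerm {x x' : PadicGerm p} (hx0 : x ≠ 0) (hx0' : x' ≠ 0)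
    (hx : (boundedGerms p).valuation x < 1) (hx' : (boundedGerms p).valuation x' < 1)
    (h : ∀ n, 0 < n → PowEquiv n x x') {ι : Type*} (P : ι → ℚ_[p][X]) :
    SameType (fun q => (P q).eval₂ (constGerm p) x) (fun q => (P q).eval₂ (constGerm p) x') := by
  intro g n hn
  have e : ∀ x : PadicGerm p, MvPolynomial.aeval (fun q => (P q).eval₂ (constGerm p) x) g =
      (MvPolynomial.aeval P g).eval₂ (constGerm p) x := fun x =>
    (MvPolynomial.comp_aeval_apply P (eval₂RingHom (constGerm p) x).toIntAlgHom g).symm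
  rw [e, e]
  exact (powEquiv_eval₂_constGerm hn hx0 hx _).trans
    (((PowEquiv.refl n _).mul ((h n hn).pow _)).trans (powEquiv_eval₂_constGerm hn hx0' hx' _).symm)

end Constants

section Sequences

variable {p : ℕ} [hp : Fact p.Prime]

theorem Padic.tendsto_zero_of_le_valuation {x : ℕ → ℚ_[p]} (hx0 : ∀ k, x k ≠ 0)
    (hx : ∀ k : ℕ, (k : ℤ) ≤ (x k).valuation) : Tendsto x atTop (𝓝 0) := by
  have hp1 : (1 : ℝ) < p := by exact_mod_cast hp.out.one_lt
  refine squeeze_zero_norm (a := fun k : ℕ => ((p : ℝ)⁻¹) ^ k) (fun k => ?_)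
    (tendsto_pow_atTop_nhds_zero_of_lt_one (by positivity) (inv_lt_one_of_one_lt₀ hp1))
  rw [Padic.norm_eq_zpow_neg_valuation (hx0 k), inv_pow, ← zpow_natCast, ← zpow_neg]
  exact zpow_le_zpow_right₀ hp1.le (neg_le_neg (hx k))

theorem PowEquiv.of_eq_pow {K : Type*} [Field K] {x x' : K} {n : ℕ} (hx0 : x ≠ 0) (hx0' : x' ≠ 0)
    (hn : 0 < n) (hx : ∃ y, y ^ n = x) (hx' : ∃ y, y ^ n = x') : PowEquiv n x x' := by
  obtain ⟨y, rfl⟩ := hx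
  obtain ⟨y', rfl⟩ := hx'
  have hy := (pow_ne_zero_iff hn.ne').1 hx0
  have hy' := (pow_ne_zero_iff hn.ne').1 hx0'
  exact ⟨y / y', div_ne_zero hy hy', by rw [← mul_pow, mul_div_cancel₀ _ hy']⟩

theorem eventually_mem_iff_of_definable {S : Set (Fin 2 → ℚ_[p])}
    (hS : Set.Definable (Set.univ : Set ℚ_[p]) Language.ring S) {x x' : ℕ → ℚ_[p]}
    (hx0 : ∀ k, x k ≠ 0) (hx0' : ∀ k, x' k ≠ 0)
    (hx : Tendsto x (hyperfilter ℕ : Filter ℕ) (𝓝 0))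
    (hx' : Tendsto x' (hyperfilter ℕ : Filter ℕ) (𝓝 0))
    (h : ∀ n, 0 < n → ∀ᶠ k in (hyperfilter ℕ : Filter ℕ), PowEquiv n (x k) (x' k)) (a : ℚ_[p]) :
    (∀ᶠ k in (hyperfilter ℕ : Filter ℕ), ![x k, a] ∈ S) ↔
      ∀ᶠ k in (hyperfilter ℕ : Filter ℕ), ![x' k, a] ∈ S := by
  obtain ⟨A, -, hA⟩ := Set.definable_iff_finitely_definable.1 hS
  obtain ⟨φ, rfl⟩ := Set.definable_iff_exists_formula_sum.1 hA
  have hne : ∀ {x : ℕ → ℚ_[p]}, (∀ k, x k ≠ 0) → (x : PadicGerm p) ≠ 0 := fun hx0 h0 => by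
    obtain ⟨k, hk⟩ := (Germ.coe_eq.1 h0).exists
    exact hx0 k hk
  have htype := sameType_eval₂_constGerm (hne hx0) (hne hx0')
    (boundedGerms_valuation_lt_one_iff.2 hx) (boundedGerms_valuation_lt_one_iff.2 hx')
    (fun n hn => powEquiv_germ_iff.2 (h n hn))
    (Sum.elim (Sum.elim (fun c : (A : Set ℚ_[p]) => Polynomial.C (c : ℚ_[p]))
      ![Polynomial.X, Polynomial.C a]) (Fin.elim0 : Fin 0 → Polynomial ℚ_[p]))
  let V : (ℕ → ℚ_[p]) → (A : Set ℚ_[p]) ⊕ Fin 2 → ℕ → ℚ_[p] := fun x =>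
    Sum.elim (fun c _ => c) ![x, fun _ => a]
  have e : ∀ x : ℕ → ℚ_[p],
      (fun q => (Sum.elim (Sum.elim (fun c : (A : Set ℚ_[p]) => Polynomial.C (c : ℚ_[p]))
        ![Polynomial.X, Polynomial.C a]) (Fin.elim0 : Fin 0 → Polynomial ℚ_[p]) q).eval₂
          (constGerm p) (x : PadicGerm p)) =
      fun q => ((Sum.elim (V x) (Fin.elim0 : Fin 0 → ℕ → ℚ_[p]) q : ℕ → ℚ_[p]) :
        PadicGerm p) := by
    intro x
    ext ((c | j) | j)
    · exact Polynomial.eval₂_C _ _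
    · fin_cases j
      · exact Polynomial.eval₂_X _ _
      · exact Polynomial.eval₂_C _ _
    · exact j.elim0
  rw [e, e] at htype
  have key := @CoarselyHenselian.eventually_realize_iff ℚ_[p] _ (Ring.compatibleRingOfRing ℚ_[p])
    _ _ _ coarselyHenselian_boundedGerms _ _ _ φ _ _ _ _ htype
  have e' : ∀ (x : ℕ → ℚ_[p]) k, ![x k, a] ∈ {v | φ.Realize (Sum.elim (↑) v)} ↔
      Language.BoundedFormula.Realize φ (fun q => V x q k)
        (fun j => (Fin.elim0 j : ℕ → ℚ_[p]) k) := by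
    intro x k
    have : (Sum.elim (fun c : (A : Set ℚ_[p]) => (c : ℚ_[p])) ![x k, a]) = fun q => V x q k := by
      ext (c | j)
      · rfl
      · fin_cases j <;> rfl
    rw [← this]
    exact iff_of_eq (congrArg (Language.BoundedFormula.Realize φ _) (Subsingleton.elim _ _))
  exact (eventually_congr (.of_forall (e' x))).trans
    (key.trans (eventually_congr (.of_forall (e' x'))).symm)

end Sequences

/-- **Definable functions with finite image are eventually constant along powers.**
Let `f : ℚ_p → ℚ_p` be definable with finite image on `D = {x ≠ 0 : v(x) ≥ ε, x ∈ P_n}`.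
Then there are `δ ≥ ε` and a positive multiple `m` of `n` such that `f` is constant on
`{x ≠ 0 : v(x) ≥ δ, x ∈ P_m}`. -/
theorem stmt18 (p : ℕ) [Fact p.Prime] (n : ℕ) (hn : 1 ≤ n) (ε : ℤ)
    (f : ℚ_[p] → ℚ_[p])
    (hfdef : Set.Definable (Set.univ : Set ℚ_[p]) FirstOrder.Language.ring
      {v : Fin 2 → ℚ_[p] | f (v 0) = v 1})
    (hfin : (f '' {x : ℚ_[p] | x ≠ 0 ∧ ε ≤ x.valuation ∧ ∃ y : ℚ_[p], y ^ n = x}).Finite) :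
    ∃ δ : ℤ, ε ≤ δ ∧ ∃ m : ℕ, 0 < m ∧ n ∣ m ∧
      ∀ x x' : ℚ_[p],
        (x ≠ 0 ∧ δ ≤ x.valuation ∧ ∃ y : ℚ_[p], y ^ m = x) →
        (x' ≠ 0 ∧ δ ≤ x'.valuation ∧ ∃ y : ℚ_[p], y ^ m = x') →
        f x = f x' := by
  by_contra hcon
  have hex : ∀ k : ℕ, ∃ x x' : ℚ_[p],
      (x ≠ 0 ∧ max ε k ≤ x.valuation ∧ ∃ y : ℚ_[p], y ^ (n * (k + 1).factorial) = x) ∧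
      (x' ≠ 0 ∧ max ε k ≤ x'.valuation ∧ ∃ y : ℚ_[p], y ^ (n * (k + 1).factorial) = x') ∧
      f x ≠ f x' := by
    intro k
    by_contra! h
    exact hcon ⟨max ε k, le_max_left _ _, n * (k + 1).factorial,
      Nat.mul_pos hn (Nat.factorial_pos _), dvd_mul_right _ _, h⟩
  choose x x' hx hx' hne using hex
  have hmem : ∀ᶠ k in (hyperfilter ℕ : Filter ℕ), ∃ a ∈ f '' {x : ℚ_[p] | x ≠ 0 ∧
      ε ≤ x.valuation ∧ ∃ y : ℚ_[p], y ^ n = x}, f (x k) = a := by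
    refine Eventually.of_forall fun k => ⟨_, Set.mem_image_of_mem f ⟨(hx k).1,
      (le_max_left _ _).trans (hx k).2.1, ?_⟩, rfl⟩
    obtain ⟨y, hy⟩ := (hx k).2.2
    exact ⟨y ^ (k + 1).factorial, by rw [← hy, ← pow_mul, mul_comm]⟩
  obtain ⟨a, -, ha⟩ := (Ultrafilter.eventually_exists_mem_iff hfin).1 hmem
  have hpow : ∀ m, 0 < m → ∀ᶠ k in (hyperfilter ℕ : Filter ℕ), PowEquiv m (x k) (x' k) := by
    intro m hm
    filter_upwards [Nat.hyperfilter_le_atTop (eventually_ge_atTop m)] with k hk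
    exact (PowEquiv.of_eq_pow (hx k).1 (hx' k).1 (Nat.mul_pos hn (Nat.factorial_pos _))
      (hx k).2.2 (hx' k).2.2).of_dvd
      (dvd_mul_of_dvd_right (Nat.dvd_factorial hm (Nat.le_succ_of_le hk)) _)
  have htendsto := (Padic.tendsto_zero_of_le_valuation (fun k => (hx k).1)
    fun k => (le_max_right _ _).trans (hx k).2.1).mono_left Nat.hyperfilter_le_atTop
  have htendsto' := (Padic.tendsto_zero_of_le_valuation (fun k => (hx' k).1)
    fun k => (le_max_right _ _).trans (hx' k).2.1).mono_left Nat.hyperfilter_le_atTop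
  have ha' := (eventually_mem_iff_of_definable hfdef (fun k => (hx k).1) (fun k => (hx' k).1)
    htendsto htendsto' hpow a).1 ha
  obtain ⟨k, hk, hk'⟩ := (ha.and ha').exists
  exact hne k (hk.trans hk'.symm)
end

section
/- Let p be a prime, n, m ≥ 1, U ⊆ (Fin n → ℚ_p) open, a ∈ U, and f : (Fin n → ℚ_p) → (Fin m → ℚ_p). Then f admits a strict Fréchet derivative at a (there exists a continuous ℚ_p-linear map A with HasStrictFDerivAt f A a) if and only if for every i : Fin n there exists g_i ∈ (Fin m → ℚ_p) such that ε⁻¹ • (f (x + ε • e_i) - f x) tends to g_i as (x, ε) → (a, 0) with ε ≠ 0, where e_i is the i-th standard basis vector; moreover, in that case A e_i = g_i for every i. -/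
open Filter Topology

section StrictPartial

open Asymptotics

variable {𝕜 E F : Type*} [NontriviallyNormedField 𝕜] [NormedAddCommGroup E] [NormedSpace 𝕜 E]
  [NormedAddCommGroup F] [NormedSpace 𝕜 F]

/-- Convergence of the difference quotient of `f` in the direction `v`, uniformly in the base
point, as a little-o estimate. -/
theorem tendsto_slope_iff_isLittleO {f : E → F} {a v : E} {g : F} :
    Tendsto (fun q : E × 𝕜 => q.2⁻¹ • (f (q.1 + q.2 • v) - f q.1))
        (𝓝[{q : E × 𝕜 | q.2 ≠ 0}] (a, 0)) (𝓝 g) ↔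
      (fun q : E × 𝕜 => f (q.1 + q.2 • v) - f q.1 - q.2 • g) =o[𝓝 (a, 0)] Prod.snd := by
  have key (q : E × 𝕜) (hq : q.2 ≠ 0) (c : ℝ) :
      ‖q.2⁻¹ • (f (q.1 + q.2 • v) - f q.1) - g‖ ≤ c ↔
        ‖f (q.1 + q.2 • v) - f q.1 - q.2 • g‖ ≤ c * ‖q.2‖ := by
    have h : q.2⁻¹ • (f (q.1 + q.2 • v) - f q.1) - g =
        q.2⁻¹ • (f (q.1 + q.2 • v) - f q.1 - q.2 • g) := by
      rw [smul_sub _ _ (q.2 • g), inv_smul_smul₀ hq]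
    rw [h, norm_smul, norm_inv, inv_mul_le_iff₀ (norm_pos_iff.2 hq), mul_comm]
  rw [tendsto_iff_norm_sub_tendsto_zero, ← isLittleO_one_iff ℝ, isLittleO_norm_left,
    isLittleO_iff, isLittleO_iff]
  refine forall₂_congr fun c _ => ?_
  rw [eventually_nhdsWithin_iff]
  refine eventually_congr (Eventually.of_forall fun q => ?_)
  by_cases hq : q.2 = 0
  · simp [hq]
  · simp only [Set.mem_ofPred_eq, norm_one, mul_one]
    rw [← key q hq c]
    exact ⟨fun h => h hq, fun h _ => h⟩

/-- A strict Fréchet derivative computes the limits of difference quotients. -/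
theorem HasStrictFDerivAt.tendsto_slope {f : E → F} {A : E →L[𝕜] F} {a : E}
    (h : HasStrictFDerivAt f A a) (v : E) :
    Tendsto (fun q : E × 𝕜 => q.2⁻¹ • (f (q.1 + q.2 • v) - f q.1))
      (𝓝[{q : E × 𝕜 | q.2 ≠ 0}] (a, 0)) (𝓝 (A v)) := by
  rw [tendsto_slope_iff_isLittleO]
  have ht : Tendsto (fun q : E × 𝕜 => (q.1 + q.2 • v, q.1)) (𝓝 (a, 0)) (𝓝 (a, a)) := by
    have hc : Continuous fun q : E × 𝕜 => (q.1 + q.2 • v, q.1) := by fun_prop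
    simpa using hc.tendsto (a, 0)
  have h1 := h.isLittleO.comp_tendsto ht
  simp only [Function.comp_def, add_sub_cancel_left, map_smul] at h1
  refine h1.trans_isBigO (IsBigO.of_bound ‖v‖ (Eventually.of_forall fun q => ?_))
  rw [norm_smul, mul_comm]

/-- If all strict partial derivatives exist, then so does the strict Fréchet derivative. -/
theorem hasStrictFDerivAt_of_tendsto_slope_single {n : ℕ} {f : (Fin n → 𝕜) → F}
    {a : Fin n → 𝕜} {g : Fin n → F}
    (h : ∀ i, Tendsto
      (fun q : (Fin n → 𝕜) × 𝕜 => q.2⁻¹ • (f (q.1 + q.2 • Pi.single i 1) - f q.1))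
      (𝓝[{q : (Fin n → 𝕜) × 𝕜 | q.2 ≠ 0}] (a, 0)) (𝓝 (g i))) :
    HasStrictFDerivAt f
      (∑ i, (ContinuousLinearMap.proj i : (Fin n → 𝕜) →L[𝕜] 𝕜).smulRight (g i)) a := by
  let z : ℕ → (Fin n → 𝕜) × (Fin n → 𝕜) → Fin n → 𝕜 :=
    fun k q j => if (j : ℕ) < k then q.1 j else q.2 j
  have hz (k : ℕ) : Continuous (z k) := by
    refine continuous_pi fun j => ?_
    by_cases hj : (j : ℕ) < k
    · simp only [z, hj, if_true]; fun_prop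
    · simp only [z, hj, if_false]; fun_prop
  have hstep (i : Fin n) (q : (Fin n → 𝕜) × (Fin n → 𝕜)) :
      z i q + (q.1 i - q.2 i) • Pi.single i 1 = z (i + 1) q := by
    ext j
    by_cases hj : j = i
    · subst hj; simp [z]
    · have hj' : (j : ℕ) ≠ i := fun h => hj (Fin.ext h)
      have hlt : (j : ℕ) < i + 1 ↔ (j : ℕ) < i := by omega
      simp [z, hj, hlt]
  have hpart (i : Fin n) :
      (fun q : (Fin n → 𝕜) × (Fin n → 𝕜) =>
        f (z (i + 1) q) - f (z i q) - (q.1 i - q.2 i) • g i) =o[𝓝 (a, a)]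
        fun q => q.1 - q.2 := by
    have ht : Tendsto (fun q : (Fin n → 𝕜) × (Fin n → 𝕜) => (z i q, q.1 i - q.2 i))
        (𝓝 (a, a)) (𝓝 (a, 0)) := by
      have hc : Continuous fun q : (Fin n → 𝕜) × (Fin n → 𝕜) => (z i q, q.1 i - q.2 i) :=
        (hz i).prodMk (by fun_prop)
      simpa [z] using hc.tendsto (a, a)
    have h1 := (tendsto_slope_iff_isLittleO.1 (h i)).comp_tendsto ht
    simp only [Function.comp_def, hstep] at h1
    exact h1.trans_isBigO (IsBigO.of_bound 1 (Eventually.of_forall fun q => by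
      simpa using norm_le_pi_norm (q.1 - q.2) i))
  refine HasStrictFDerivAt.of_isLittleO ((IsLittleO.sum fun i (_ : i ∈ Finset.univ) =>
    hpart i).congr_left fun q => ?_)
  rw [Finset.sum_apply, Finset.sum_sub_distrib,
    Fin.sum_univ_eq_sum_range (fun k => f (z (k + 1) q) - f (z k q)),
    Finset.sum_range_sub (fun k => f (z k q))]
  simp [z]

end StrictPartial

/-- **Characterization of strict Fréchet differentiability via strict partial derivatives.**
For `f : ℚ_p^n → ℚ_p^m` and `a` in an open set `U`, `f` has a strict Fréchet derivative
at `a` iff for each `i` the strict partial difference quotient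
`ε⁻¹ • (f (x + ε • eᵢ) - f x)` converges as `(x, ε) → (a, 0)` with `ε ≠ 0`; moreover for
any strict derivative `A` the limit in direction `i` is `A eᵢ`. -/
theorem stmt19 (p : ℕ) [Fact p.Prime] (n m : ℕ) (hn : 1 ≤ n) (hm : 1 ≤ m)
    (U : Set (Fin n → ℚ_[p])) (hUopen : IsOpen U) (a : Fin n → ℚ_[p]) (ha : a ∈ U)
    (f : (Fin n → ℚ_[p]) → (Fin m → ℚ_[p])) :
    ((∃ A : (Fin n → ℚ_[p]) →L[ℚ_[p] ] (Fin m → ℚ_[p]), HasStrictFDerivAt f A a) ↔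
      (∀ i : Fin n, ∃ g : Fin m → ℚ_[p],
        Filter.Tendsto
          (fun q : (Fin n → ℚ_[p]) × ℚ_[p] =>
            q.2⁻¹ • (f (q.1 + q.2 • (Pi.single i 1 : Fin n → ℚ_[p])) - f q.1))
          (𝓝[{q : (Fin n → ℚ_[p]) × ℚ_[p] | q.2 ≠ 0}] (a, 0)) (𝓝 g))) ∧
    (∀ A : (Fin n → ℚ_[p]) →L[ℚ_[p] ] (Fin m → ℚ_[p]), HasStrictFDerivAt f A a →
      ∀ i : Fin n,
        Filter.Tendsto
          (fun q : (Fin n → ℚ_[p]) × ℚ_[p] =>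
            q.2⁻¹ • (f (q.1 + q.2 • (Pi.single i 1 : Fin n → ℚ_[p])) - f q.1))
          (𝓝[{q : (Fin n → ℚ_[p]) × ℚ_[p] | q.2 ≠ 0}] (a, 0))
          (𝓝 (A (Pi.single i 1 : Fin n → ℚ_[p])))) := by
  refine ⟨⟨fun ⟨A, hA⟩ i => ⟨_, hA.tendsto_slope _⟩, fun h => ?_⟩,
    fun A hA i => hA.tendsto_slope _⟩
  choose g hg using h
  exact ⟨_, hasStrictFDerivAt_of_tendsto_slope_single hg⟩
end
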